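/- arXiv:2203.01599 — 2 statements merged into one kernel-verified Lean document; each statement's English description precedes it below -/
import Mathlib

section
/- Let d = 2^ℓ, let ε, δ ∈ (0, 1/2), and let 𝒲 ⊂ ℝ^d be bounded with diameter Diam(𝒲). There are absolute constants C, c > 0 such that if m ≥ C ε⁻² (1 + Diam(𝒲))² log^c(d(1 + Diam(𝒲))/(εδ)), then with probability at least 1 − δ/2 over the random diagonal matrices, for all x, y ∈ 𝒲, |(1/(md)) Σ_{j=1}^m Σ_{k=1}^d cos(h̃_{j,k}(x − y)) − E_{Z ∼ N(0, ‖x−y‖²)}[cos(Z)]| ≤ ε/2. -/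
open MeasureTheory ProbabilityTheory Real
open scoped ENNReal NNReal Classical

noncomputable section

/-- The Sylvester–Hadamard matrix of size `2^ℓ`: `H 0 = [1]`,
`H (ℓ+1) = [[H ℓ, H ℓ],[H ℓ, -H ℓ]]`. -/
def Had : ∀ ℓ : ℕ, Matrix (Fin (2 ^ ℓ)) (Fin (2 ^ ℓ)) ℝ
  | 0 => 1
  | (ℓ + 1) =>
      Matrix.reindex (finSumFinEquiv.trans (finCongr (by rw [pow_succ, mul_two])))
        (finSumFinEquiv.trans (finCongr (by rw [pow_succ, mul_two])))
        (Matrix.fromBlocks (Had ℓ) (Had ℓ) (Had ℓ) (-(Had ℓ)))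

/-- `rht ℓ m D z j k = (H_d D^j z)_k`, the `(j,k)` entry of the randomized Hadamard
transform of `z`, where `D j` records the diagonal entries of the diagonal matrix `D^j`. -/
def rht (ℓ m : ℕ) (D : Fin m → Fin (2 ^ ℓ) → ℝ) (z : EuclideanSpace ℝ (Fin (2 ^ ℓ)))
    (j : Fin m) (k : Fin (2 ^ ℓ)) : ℝ :=
  (Had ℓ).mulVec (fun i => D j i * z i) k

/-- The joint law of the diagonal entries of `D^1, …, D^m`: i.i.d. standard Gaussians. -/
def diagMeasure (ℓ m : ℕ) : Measure (Fin m → Fin (2 ^ ℓ) → ℝ) :=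
  Measure.pi fun _ => Measure.pi fun _ => gaussianReal 0 1

section GaussianConcentration

/-- The uniform probability measure on `(0, π / 2]`. -/
def quarterTurn : Measure ℝ :=
  ENNReal.ofReal (2 / π) • volume.restrict (Set.Ioc 0 (π / 2))

instance isProbabilityMeasure_quarterTurn : IsProbabilityMeasure quarterTurn := by
  constructor
  have h : 2 / π * (π / 2) = 1 := by field_simp
  rw [quarterTurn, Measure.smul_apply, Measure.restrict_apply_univ, Real.volume_Ioc, sub_zero,
    smul_eq_mul, ← ENNReal.ofReal_mul (by positivity), h, ENNReal.ofReal_one]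

lemma integrable_quarterTurn {φ : ℝ → ℝ} (hφ : Continuous φ) : Integrable φ quarterTurn := by
  refine Integrable.smul_measure ?_ ENNReal.ofReal_ne_top
  exact (hφ.integrableOn_Icc (a := 0) (b := π / 2)).mono_set Set.Ioc_subset_Icc_self

lemma integral_quarterTurn (φ : ℝ → ℝ) :
    ∫ θ, φ θ ∂quarterTurn = 2 / π * ∫ θ in (0 : ℝ)..(π / 2), φ θ := by
  rw [quarterTurn, integral_smul_measure, ENNReal.toReal_ofReal (by positivity),
    intervalIntegral.integral_of_le (by positivity), smul_eq_mul]

variable {E : Type*} [NormedAddCommGroup E] [InnerProductSpace ℝ E]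

/-- The exponential of an increment of `f` is at most an average, over the quarter turn from `p.1`
to `p.2`, of the exponential of the derivative of `f` along the turn. -/
lemma exp_increment_le {f : E → ℝ} (hf : ContDiff ℝ 1 f) (t : ℝ) (p : E × E) :
    ENNReal.ofReal (exp (t * (f p.2 - f p.1))) ≤
      ∫⁻ θ, ENNReal.ofReal (exp (((t * (π / 2)) •
        fderiv ℝ f (ContinuousLinearMap.rotation θ p).1) (ContinuousLinearMap.rotation θ p).2))
        ∂quarterTurn := by
  have hfc : Continuous (fderiv ℝ f) := hf.continuous_fderiv (by norm_num)
  set φ : ℝ → ℝ := fun θ => fderiv ℝ f (ContinuousLinearMap.rotation θ p).1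
    (ContinuousLinearMap.rotation θ p).2 with hφ
  have hφc : Continuous φ := by
    simp only [hφ, ContinuousLinearMap.rotation_apply]
    fun_prop
  have hcurve (θ : ℝ) : HasDerivAt (fun θ => f (ContinuousLinearMap.rotation θ p).1) (φ θ) θ := by
    have h1 : HasDerivAt (fun θ => (ContinuousLinearMap.rotation θ p).1)
        (ContinuousLinearMap.rotation θ p).2 θ := by
      simp only [ContinuousLinearMap.rotation_apply]
      exact ((Real.hasDerivAt_cos θ).smul_const p.1).add ((Real.hasDerivAt_sin θ).smul_const p.2)
    exact ((hf.differentiable (by norm_num)) _).hasFDerivAt.comp_hasDerivAt θ h1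
  have hftc : ∫ θ in (0 : ℝ)..(π / 2), φ θ = f p.2 - f p.1 := by
    rw [intervalIntegral.integral_eq_sub_of_hasDerivAt (fun θ _ => hcurve θ)
      (hφc.intervalIntegrable _ _)]
    simp [ContinuousLinearMap.rotation_apply]
  have hmean : t * (f p.2 - f p.1) = ∫ θ, t * (π / 2) * φ θ ∂quarterTurn := by
    rw [integral_const_mul, integral_quarterTurn, hftc]
    field_simp
  have hinteg : Integrable (fun θ => exp (t * (π / 2) * φ θ)) quarterTurn :=
    integrable_quarterTurn (by fun_prop)
  have hjensen := convexOn_exp.map_integral_le (μ := quarterTurn)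
    (f := fun θ => t * (π / 2) * φ θ) continuous_exp.continuousOn isClosed_univ (by simp)
    (integrable_quarterTurn (by fun_prop)) hinteg
  rw [hmean]
  refine (ENNReal.ofReal_le_ofReal hjensen).trans_eq ?_
  rw [ofReal_integral_eq_lintegral_ofReal hinteg (Filter.Eventually.of_forall fun _ => (exp_pos _).le)]
  simp [hφ]

variable [FiniteDimensional ℝ E] [MeasurableSpace E] [BorelSpace E]

lemma integral_exp_strongDual_stdGaussian (L : StrongDual ℝ E) :
    ∫⁻ y, ENNReal.ofReal (exp (L y)) ∂(stdGaussian E) = ENNReal.ofReal (exp (‖L‖ ^ 2 / 2)) := by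
  have hmap : (stdGaussian E).map L = gaussianReal 0 (‖L‖ ^ 2).toNNReal := by
    rw [IsGaussian.map_eq_gaussianReal, integral_strongDual_stdGaussian, variance_dual_stdGaussian]
  have hmeas : Measurable fun u : ℝ => ENNReal.ofReal (exp u) := by fun_prop
  rw [← lintegral_map (f := fun u => ENNReal.ofReal (exp u)) hmeas L.continuous.measurable, hmap,
    ← ofReal_integral_eq_lintegral_ofReal]
  · have := congrFun (mgf_fun_id_gaussianReal (μ := 0) (v := (‖L‖ ^ 2).toNNReal)) 1
    simp only [mgf, one_mul] at this
    rw [this]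
    simp
  · simpa using integrable_exp_mul_gaussianReal (μ := 0) (v := (‖L‖ ^ 2).toNNReal) 1
  · exact Filter.Eventually.of_forall fun _ => (exp_pos _).le

/-- Maurey–Pisier: exponential moments of the increment of a Lipschitz function between two
independent standard Gaussian vectors. -/
lemma lintegral_exp_increment_le {f : E → ℝ} (hf : ContDiff ℝ 1 f) {σ : ℝ}
    (hσ : ∀ x, ‖fderiv ℝ f x‖ ≤ σ) (t : ℝ) :
    ∫⁻ p, ENNReal.ofReal (exp (t * (f p.2 - f p.1))) ∂((stdGaussian E).prod (stdGaussian E)) ≤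
      ENNReal.ofReal (exp (π ^ 2 / 4 * σ ^ 2 * t ^ 2 / 2)) := by
  have hfc : Continuous (fderiv ℝ f) := hf.continuous_fderiv (by norm_num)
  have hcont : Continuous fun q : E × E => ENNReal.ofReal (exp (((t * (π / 2)) •
      fderiv ℝ f q.1) q.2)) := by
    simp only [FunLike.coe_smul, Pi.smul_apply]
    exact ENNReal.continuous_ofReal.comp (by fun_prop)
  have hrot : Continuous fun q : (E × E) × ℝ => ContinuousLinearMap.rotation q.2 q.1 := by
    simp only [ContinuousLinearMap.rotation_apply]
    fun_prop
  refine (lintegral_mono (exp_increment_le hf t)).trans ?_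
  have hjoint : AEMeasurable (Function.uncurry fun (p : E × E) (θ : ℝ) =>
      ENNReal.ofReal (exp (((t * (π / 2)) • fderiv ℝ f (ContinuousLinearMap.rotation θ p).1)
        (ContinuousLinearMap.rotation θ p).2)))
      (((stdGaussian E).prod (stdGaussian E)).prod quarterTurn) :=
    (hcont.comp hrot).aemeasurable
  rw [lintegral_lintegral_swap hjoint]
  have hfix (θ : ℝ) : ∫⁻ p, ENNReal.ofReal (exp (((t * (π / 2)) •
        fderiv ℝ f (ContinuousLinearMap.rotation θ p).1) (ContinuousLinearMap.rotation θ p).2))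
        ∂((stdGaussian E).prod (stdGaussian E)) ≤
      ENNReal.ofReal (exp (π ^ 2 / 4 * σ ^ 2 * t ^ 2 / 2)) := by
    have hinv := IsGaussian.map_rotation_eq_self_of_forall_strongDual_eq_zero
      (μ := stdGaussian E) integral_strongDual_stdGaussian θ
    rw [← lintegral_map (f := fun q : E × E => ENNReal.ofReal (exp (((t * (π / 2)) •
      fderiv ℝ f q.1) q.2))) hcont.measurable (ContinuousLinearMap.continuous _).measurable, hinv,
      lintegral_prod _ hcont.aemeasurable]
    have hle (x : E) : ∫⁻ y, ENNReal.ofReal (exp (((t * (π / 2)) • fderiv ℝ f x) y))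
        ∂(stdGaussian E) ≤ ENNReal.ofReal (exp (π ^ 2 / 4 * σ ^ 2 * t ^ 2 / 2)) := by
      rw [integral_exp_strongDual_stdGaussian]
      refine ENNReal.ofReal_le_ofReal (exp_le_exp.2 ?_)
      have h2 : ‖fderiv ℝ f x‖ ^ 2 ≤ σ ^ 2 := by gcongr; exact hσ x
      rw [norm_smul, mul_pow, Real.norm_eq_abs, sq_abs]
      have := mul_le_mul_of_nonneg_left h2 (by positivity : 0 ≤ (t * (π / 2)) ^ 2 / 2)
      linarith
    refine (lintegral_mono hle).trans_eq ?_
    simp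
  refine (lintegral_mono hfix).trans_eq ?_
  simp

/-- Gaussian concentration: a bounded continuously differentiable Lipschitz function of a standard
Gaussian vector is sub-Gaussian around its mean. -/
lemma hasSubgaussianMGF_sub_integral {f : E → ℝ} (hf : ContDiff ℝ 1 f) {σ : ℝ}
    (hσ : ∀ x, ‖fderiv ℝ f x‖ ≤ σ) {M : ℝ} (hM : ∀ x, |f x| ≤ M) :
    HasSubgaussianMGF (fun x => f x - ∫ y, f y ∂(stdGaussian E))
      (π ^ 2 / 4 * σ ^ 2).toNNReal (stdGaussian E) := by
  have hfc : Continuous f := hf.continuous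
  have hbdd {α : Type _} [MeasurableSpace α] (ν : Measure α) [IsProbabilityMeasure ν] (g : α → ℝ)
      (hg : AEStronglyMeasurable g ν) (c : ℝ) (hc : ∀ a, |g a| ≤ c) : Integrable g ν :=
    Integrable.of_bound hg c (Filter.Eventually.of_forall hc)
  have hexp {α : Type _} [MeasurableSpace α] (ν : Measure α) [IsProbabilityMeasure ν] (g : α → ℝ)
      (hg : AEStronglyMeasurable g ν) (c : ℝ) (hc : ∀ a, |g a| ≤ c) :
      Integrable (fun a => exp (g a)) ν :=
    hbdd ν _ (continuous_exp.comp_aestronglyMeasurable hg) (exp c) fun a => by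
      rw [abs_of_pos (exp_pos _)]
      exact exp_le_exp.2 ((le_abs_self _).trans (hc a))
  have hfi : Integrable f (stdGaussian E) := hbdd _ f hfc.aestronglyMeasurable M hM
  have hdiff (t : ℝ) (x y : E) : |t * (f y - f x)| ≤ |t| * (M + M) := by
    rw [abs_mul]
    gcongr
    exact (abs_sub _ _).trans (add_le_add (hM y) (hM x))
  constructor
  · intro t
    refine hexp _ _ (by fun_prop) (|t| * (M + |∫ y, f y ∂(stdGaussian E)|)) fun x => ?_
    rw [abs_mul]
    gcongr
    exact (abs_sub _ _).trans (by gcongr; exact hM x)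
  · intro t
    have hprod : Integrable (fun p : E × E => exp (t * (f p.2 - f p.1)))
        ((stdGaussian E).prod (stdGaussian E)) :=
      hexp _ _ (by fun_prop) (|t| * (M + M)) fun p => hdiff t p.1 p.2
    have hstep (y : E) : exp (t * (f y - ∫ x, f x ∂(stdGaussian E))) ≤
        ∫ x, exp (t * (f y - f x)) ∂(stdGaussian E) := by
      have hj := convexOn_exp.map_integral_le (μ := stdGaussian E)
        (f := fun x => t * (f y - f x)) continuous_exp.continuousOn isClosed_univ (by simp)
        (hbdd _ _ (by fun_prop) (|t| * (M + M)) fun x => hdiff t x y)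
        (hexp _ _ (by fun_prop) (|t| * (M + M)) fun x => hdiff t x y)
      rwa [integral_const_mul, integral_sub (integrable_const _) hfi, integral_const,
        probReal_univ, one_smul] at hj
    have hswap : ∫ y, ∫ x, exp (t * (f y - f x)) ∂(stdGaussian E) ∂(stdGaussian E) =
        ∫ p, exp (t * (f p.2 - f p.1)) ∂((stdGaussian E).prod (stdGaussian E)) :=
      (integral_prod_symm _ hprod).symm
    rw [Real.coe_toNNReal _ (by positivity)]
    calc mgf (fun x => f x - ∫ y, f y ∂(stdGaussian E)) (stdGaussian E) t
        ≤ ∫ y, ∫ x, exp (t * (f y - f x)) ∂(stdGaussian E) ∂(stdGaussian E) :=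
          integral_mono_of_nonneg (Filter.Eventually.of_forall fun _ => (exp_pos _).le)
            hprod.swap.integral_prod_left (Filter.Eventually.of_forall hstep)
      _ ≤ exp (π ^ 2 / 4 * σ ^ 2 * t ^ 2 / 2) := by
          rw [hswap, ← ENNReal.ofReal_le_ofReal_iff (exp_pos _).le,
            ofReal_integral_eq_lintegral_ofReal hprod
              (Filter.Eventually.of_forall fun _ => (exp_pos _).le)]
          exact lintegral_exp_increment_le hf hσ t

end GaussianConcentration

section Hadamard

lemma Had_transpose_mul (ℓ : ℕ) : (Had ℓ).transpose * Had ℓ = (2 ^ ℓ : ℝ) • 1 := by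
  induction ℓ with
  | zero => simp [Had]
  | succ ℓ ih =>
    rw [Had, Matrix.transpose_reindex, Matrix.reindex_apply, Matrix.reindex_apply,
      Matrix.submatrix_mul_equiv, Matrix.fromBlocks_transpose, Matrix.fromBlocks_multiply]
    simp only [Matrix.transpose_neg, Matrix.mul_neg, Matrix.neg_mul, neg_neg, ih,
      add_neg_cancel, ← two_smul ℝ ((2 ^ ℓ : ℝ) • (1 : Matrix (Fin (2 ^ ℓ)) (Fin (2 ^ ℓ)) ℝ)),
      smul_smul]
    rw [show (2 : ℝ) * 2 ^ ℓ = 2 ^ (ℓ + 1) by ring]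
    have hblocks : Matrix.fromBlocks ((2 ^ (ℓ + 1) : ℝ) • (1 : Matrix (Fin (2 ^ ℓ)) (Fin (2 ^ ℓ)) ℝ))
        0 0 ((2 ^ (ℓ + 1) : ℝ) • (1 : Matrix (Fin (2 ^ ℓ)) (Fin (2 ^ ℓ)) ℝ)) =
        (2 ^ (ℓ + 1) : ℝ) • 1 := by
      rw [← Matrix.fromBlocks_one, Matrix.fromBlocks_smul]
      congr 1 <;> exact (smul_zero _).symm
    rw [hblocks, ← Matrix.submatrix_one_equiv
      (finSumFinEquiv.trans (finCongr (by rw [pow_succ, mul_two] : 2 ^ ℓ + 2 ^ ℓ = 2 ^ (ℓ + 1)))).symm]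
    rfl

lemma Had_sq (ℓ : ℕ) (k i : Fin (2 ^ ℓ)) : Had ℓ k i ^ 2 = 1 := by
  induction ℓ with
  | zero =>
    have h : k = i := Fin.ext (by have := k.2; have := i.2; omega)
    rw [h, Had, Matrix.one_apply_eq, one_pow]
  | succ ℓ ih =>
    rw [Had, Matrix.reindex_apply, Matrix.submatrix_apply]
    generalize (finSumFinEquiv.trans _).symm k = a
    generalize (finSumFinEquiv.trans _).symm i = b
    rcases a with a | a <;> rcases b with b | b <;> simp [ih]

lemma abs_Had (ℓ : ℕ) (k i : Fin (2 ^ ℓ)) : |Had ℓ k i| = 1 := by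
  rw [← Real.sqrt_sq_eq_abs, Had_sq, Real.sqrt_one]

lemma sum_Had_mulVec_sq (ℓ : ℕ) (u : Fin (2 ^ ℓ) → ℝ) :
    ∑ k, (Had ℓ).mulVec u k ^ 2 = 2 ^ ℓ * ∑ i, u i ^ 2 := by
  have h : (Had ℓ).mulVec u ⬝ᵥ (Had ℓ).mulVec u = 2 ^ ℓ * (u ⬝ᵥ u) := by
    rw [Matrix.dotProduct_mulVec, ← Matrix.mulVec_transpose, Matrix.mulVec_mulVec,
      Had_transpose_mul, Matrix.smul_mulVec, Matrix.one_mulVec, smul_dotProduct, smul_eq_mul]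
  simpa [dotProduct, sq] using h

lemma abs_Had_mulVec_le (ℓ : ℕ) (u : Fin (2 ^ ℓ) → ℝ) (k : Fin (2 ^ ℓ)) :
    |(Had ℓ).mulVec u k| ≤ ∑ i, |u i| := by
  have h : |∑ i, Had ℓ k i * u i| ≤ ∑ i, |Had ℓ k i * u i| := Finset.abs_sum_le_sum_abs _ _
  simp only [abs_mul, abs_Had, one_mul] at h
  exact h

/-- The mean over `k` of the absolute values of `H u` is at most the Euclidean norm of `u`. -/
lemma mean_abs_Had_mulVec_le (ℓ : ℕ) (u : Fin (2 ^ ℓ) → ℝ) :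
    (2 ^ ℓ : ℝ)⁻¹ * ∑ k, |(Had ℓ).mulVec u k| ≤ √(∑ i, u i ^ 2) := by
  apply Real.le_sqrt_of_sq_le
  have h := sq_sum_le_card_mul_sum_sq (s := Finset.univ) (f := fun k => |(Had ℓ).mulVec u k|)
  simp only [sq_abs, sum_Had_mulVec_sq, Finset.card_univ, Fintype.card_fin, Nat.cast_pow,
    Nat.cast_ofNat] at h
  rw [mul_pow, inv_pow, inv_mul_le_iff₀ (by positivity)]
  linarith

end Hadamard

section Block

variable {ℓ : ℕ}

/-- The average of the cosines of the coordinates of `a + H (v ⊙ w)`. -/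
def shiftedCosMean (ℓ : ℕ) (a w v : Fin (2 ^ ℓ) → ℝ) : ℝ :=
  (2 ^ ℓ : ℝ)⁻¹ * ∑ k, cos (a k + (Had ℓ).mulVec (fun i => v i * w i) k)

lemma abs_shiftedCosMean_le_one (a w v : Fin (2 ^ ℓ) → ℝ) : |shiftedCosMean ℓ a w v| ≤ 1 := by
  rw [shiftedCosMean, abs_mul, abs_of_pos (by positivity), inv_mul_le_iff₀ (by positivity), mul_one]
  refine (Finset.abs_sum_le_sum_abs _ _).trans ?_
  refine (Finset.sum_le_sum fun k _ => abs_cos_le_one _).trans ?_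
  simp

lemma continuous_shiftedCosMean (a w : Fin (2 ^ ℓ) → ℝ) :
    Continuous (shiftedCosMean ℓ a w) := by
  unfold shiftedCosMean Matrix.mulVec dotProduct
  fun_prop

lemma abs_shiftedCosMean_sub_le (a w v w' v' : Fin (2 ^ ℓ) → ℝ) :
    |shiftedCosMean ℓ a w v - shiftedCosMean ℓ a w' v'| ≤
      (2 ^ ℓ : ℝ)⁻¹ * ∑ k, |(Had ℓ).mulVec (fun i => v i * w i - v' i * w' i) k| := by
  rw [shiftedCosMean, shiftedCosMean, ← mul_sub, abs_mul, abs_of_pos (by positivity),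
    ← Finset.sum_sub_distrib]
  gcongr
  refine (Finset.abs_sum_le_sum_abs _ _).trans (Finset.sum_le_sum fun k _ => ?_)
  refine (abs_cos_sub_cos_le _ _).trans_eq ?_
  congr 1
  have : (fun i => v i * w i - v' i * w' i) = (fun i => v i * w i) - fun i => v' i * w' i := rfl
  rw [this, Matrix.mulVec_sub, Pi.sub_apply]
  ring

lemma integral_cos_add_gaussianReal (a : ℝ) (s : ℝ≥0) :
    ∫ u, cos (a + u) ∂(gaussianReal 0 s) = exp (-(s : ℝ) / 2) * cos a := by
  have hI : Integrable (fun u : ℝ => Complex.exp (u * Complex.I)) (gaussianReal 0 s) :=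
    Integrable.of_bound (by fun_prop) 1 (Filter.Eventually.of_forall fun u => by
      rw [Complex.norm_exp_ofReal_mul_I])
  have h := charFun_gaussianReal (μ := 0) (v := s) 1
  rw [charFun_apply_real] at h
  have hpt (u : ℝ) : cos (a + u) = RCLike.re (Complex.exp (a * Complex.I) *
      Complex.exp (u * Complex.I)) := by
    rw [← Complex.exp_add, ← add_mul, ← Complex.ofReal_add]
    exact (Complex.exp_ofReal_mul_I_re _).symm
  simp_rw [hpt]
  rw [integral_re (hI.const_mul _), integral_const_mul]
  simp only [Complex.ofReal_one, one_mul] at h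
  rw [h]
  have h2 : Complex.exp ((Complex.ofReal 0) * Complex.I - (s : ℂ) * 1 ^ 2 / 2) =
      ((exp (-(s : ℝ) / 2) : ℝ) : ℂ) := by
    push_cast
    congr 1
    simp
    ring
  rw [h2, mul_comm, RCLike.re_eq_complex_re, Complex.re_ofReal_mul, Complex.exp_ofReal_mul_I_re]

lemma integral_shiftedCosMean (a w : Fin (2 ^ ℓ) → ℝ) :
    ∫ v, shiftedCosMean ℓ a w v.ofLp ∂(stdGaussian (EuclideanSpace ℝ (Fin (2 ^ ℓ)))) =
      exp (-(∑ i, w i ^ 2) / 2) * ((2 ^ ℓ : ℝ)⁻¹ * ∑ k, cos (a k)) := by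
  have hk (k : Fin (2 ^ ℓ)) :
      ∫ v, cos (a k + (Had ℓ).mulVec (fun i => v.ofLp i * w i) k)
        ∂(stdGaussian (EuclideanSpace ℝ (Fin (2 ^ ℓ)))) =
      exp (-(∑ i, w i ^ 2) / 2) * cos (a k) := by
    set c : EuclideanSpace ℝ (Fin (2 ^ ℓ)) := WithLp.toLp 2 fun i => Had ℓ k i * w i with hc
    have hnorm : ‖innerSL ℝ c‖ ^ 2 = ∑ i, w i ^ 2 := by
      rw [innerSL_apply_norm, EuclideanSpace.real_norm_sq_eq]
      simp [hc, mul_pow, Had_sq]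
    have hmap : (stdGaussian (EuclideanSpace ℝ (Fin (2 ^ ℓ)))).map (innerSL ℝ c) =
        gaussianReal 0 (∑ i, w i ^ 2).toNNReal := by
      rw [IsGaussian.map_eq_gaussianReal, integral_strongDual_stdGaussian,
        variance_dual_stdGaussian, hnorm]
    have hpt (v : EuclideanSpace ℝ (Fin (2 ^ ℓ))) :
        (Had ℓ).mulVec (fun i => v.ofLp i * w i) k = innerSL ℝ c v := by
      simp only [innerSL_apply_apply, PiLp.inner_apply, hc, Matrix.mulVec, dotProduct]
      refine Finset.sum_congr rfl fun i _ => ?_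
      simp
      ring
    simp_rw [hpt]
    rw [← integral_map (φ := innerSL ℝ c) (f := fun u => cos (a k + u))
      (ContinuousLinearMap.continuous _).aemeasurable
      (by fun_prop), hmap, integral_cos_add_gaussianReal,
      Real.coe_toNNReal _ (Finset.sum_nonneg fun i _ => sq_nonneg _)]
  simp only [shiftedCosMean]
  rw [integral_const_mul, integral_finsetSum]
  · simp_rw [hk, ← Finset.mul_sum]
    ring
  · intro k _
    refine Integrable.of_bound ?_ 1 (Filter.Eventually.of_forall fun v => abs_cos_le_one _)
    unfold Matrix.mulVec dotProduct
    fun_prop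

/-- Concentration of one block with frozen shift `a`, with variance proxy governed by the sup norm
of `w`. -/
lemma hasSubgaussianMGF_shiftedCosMean (a w : Fin (2 ^ ℓ) → ℝ) {σ : ℝ} (hw : ∀ i, |w i| ≤ σ) :
    HasSubgaussianMGF (fun v => shiftedCosMean ℓ a w v -
        exp (-(∑ i, w i ^ 2) / 2) * ((2 ^ ℓ : ℝ)⁻¹ * ∑ k, cos (a k)))
      (π ^ 2 / 4 * σ ^ 2).toNNReal (Measure.pi fun _ => gaussianReal 0 1) := by
  have hσ : 0 ≤ σ := (abs_nonneg _).trans (hw ⟨0, by positivity⟩)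
  set f : EuclideanSpace ℝ (Fin (2 ^ ℓ)) → ℝ := fun v => shiftedCosMean ℓ a w v.ofLp with hf
  have hsmooth : ContDiff ℝ 1 f := by
    simp only [hf]
    unfold shiftedCosMean Matrix.mulVec dotProduct
    fun_prop
  have hlip : LipschitzWith σ.toNNReal f := by
    refine LipschitzWith.of_dist_le_mul fun v v' => ?_
    rw [Real.dist_eq, Real.coe_toNNReal _ hσ, dist_eq_norm, EuclideanSpace.norm_eq]
    refine (abs_shiftedCosMean_sub_le a w v.ofLp w v'.ofLp).trans
      ((mean_abs_Had_mulVec_le ℓ _).trans ?_)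
    rw [← Real.sqrt_sq hσ, ← Real.sqrt_mul (sq_nonneg σ)]
    apply Real.sqrt_le_sqrt
    rw [Finset.mul_sum]
    refine Finset.sum_le_sum fun i _ => ?_
    rw [← sub_mul, mul_pow, mul_comm, PiLp.sub_apply, Real.norm_eq_abs, sq_abs]
    exact mul_le_mul_of_nonneg_right (sq_le_sq.2 ((hw i).trans (le_abs_self σ))) (sq_nonneg _)
  have hder (v) : ‖fderiv ℝ f v‖ ≤ σ := by
    simpa [Real.coe_toNNReal _ hσ] using norm_fderiv_le_of_lipschitz ℝ hlip (x₀ := v)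
  have h := hasSubgaussianMGF_sub_integral hsmooth hder
    (fun v => abs_shiftedCosMean_le_one a w v.ofLp)
  rw [hf, integral_shiftedCosMean, ← map_pi_eq_stdGaussian] at h
  exact HasSubgaussianMGF.of_map (Y := WithLp.toLp 2) (by fun_prop) h

/-- Mixing the coordinates of two independent samples of a product measure gives a sample of the
same product measure. -/
lemma map_mix_pi {ι : Type*} [Fintype ι] (μ : ι → Measure ℝ) [∀ i, IsProbabilityMeasure (μ i)]
    (S : ι → Prop) [DecidablePred S] :
    ((Measure.pi μ).prod (Measure.pi μ)).map (fun p i => if S i then p.1 i else p.2 i) =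
      Measure.pi μ := by
  have hmeas : Measurable fun (p : (ι → ℝ) × (ι → ℝ)) i => if S i then p.1 i else p.2 i := by
    refine measurable_pi_lambda _ fun i => ?_
    split_ifs <;> fun_prop
  refine (Measure.pi_eq fun s hs => ?_).symm
  rw [Measure.map_apply hmeas (MeasurableSet.univ_pi hs)]
  have hset : (fun (p : (ι → ℝ) × (ι → ℝ)) i => if S i then p.1 i else p.2 i) ⁻¹'
      Set.univ.pi s = (Set.univ.pi fun i => if S i then s i else Set.univ) ×ˢ
        (Set.univ.pi fun i => if S i then Set.univ else s i) := by
    ext p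
    simp only [Set.mem_preimage, Set.mem_univ_pi, Set.mem_prod, ← forall_and]
    refine forall_congr' fun i => ?_
    split_ifs <;> simp
  rw [hset, Measure.prod_prod, Measure.pi_pi, Measure.pi_pi, ← Finset.prod_mul_distrib]
  refine Finset.prod_congr rfl fun i _ => ?_
  split_ifs <;> simp

/-- Adding a vector `w` supported off the support of `y` multiplies the block average of cosines
by `exp (-‖w‖² / 2)`, up to a sub-Gaussian error governed by the sup norm of `w`. -/
lemma hasSubgaussianMGF_shiftedCosMean_add (y w : Fin (2 ^ ℓ) → ℝ)
    (hyw : ∀ i, y i = 0 ∨ w i = 0) {σ : ℝ} (hw : ∀ i, |w i| ≤ σ) :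
    HasSubgaussianMGF (fun v => shiftedCosMean ℓ 0 (y + w) v -
        exp (-(∑ i, w i ^ 2) / 2) * shiftedCosMean ℓ 0 y v)
      (π ^ 2 / 4 * σ ^ 2).toNNReal (Measure.pi fun _ => gaussianReal 0 1) := by
  set γ : Measure (Fin (2 ^ ℓ) → ℝ) := Measure.pi fun _ => gaussianReal 0 1 with hγ
  set g : (Fin (2 ^ ℓ) → ℝ) → ℝ := fun v => shiftedCosMean ℓ 0 (y + w) v -
        exp (-(∑ i, w i ^ 2) / 2) * shiftedCosMean ℓ 0 y v with hg
  have hgc : Continuous g :=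
    (continuous_shiftedCosMean _ _).sub ((continuous_shiftedCosMean _ _).const_mul _)
  have hgb (v) : |g v| ≤ 2 := by
    have h1 := abs_shiftedCosMean_le_one 0 (y + w) v
    have h2 := abs_shiftedCosMean_le_one 0 y v
    have h3 : exp (-(∑ i, w i ^ 2) / 2) ≤ 1 := exp_le_one_iff.2 (by
      have := Finset.sum_nonneg fun i (_ : i ∈ Finset.univ) => sq_nonneg (w i)
      linarith)
    refine (abs_sub _ _).trans ?_
    rw [abs_mul, abs_of_pos (exp_pos _)]
    nlinarith [exp_pos (-(∑ i, w i ^ 2) / 2), abs_nonneg (shiftedCosMean ℓ 0 y v)]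
  have hinteg (t : ℝ) : Integrable (fun v => exp (t * g v)) γ := by
    refine Integrable.of_bound (by fun_prop) (exp (|t| * 2)) (Filter.Eventually.of_forall fun v => ?_)
    rw [Real.norm_eq_abs, abs_of_pos (exp_pos _), exp_le_exp]
    refine (le_abs_self _).trans ?_
    rw [abs_mul]
    gcongr
    exact hgb v
  refine ⟨hinteg, fun t => ?_⟩
  set mix : (Fin (2 ^ ℓ) → ℝ) × (Fin (2 ^ ℓ) → ℝ) → Fin (2 ^ ℓ) → ℝ :=
    fun p i => if w i = 0 then p.1 i else p.2 i with hmix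
  have hmixmeas : Measurable mix := by
    refine measurable_pi_lambda _ fun i => ?_
    simp only [hmix]
    split_ifs <;> fun_prop
  have hmap : (γ.prod γ).map mix = γ := map_mix_pi _ _
  have hgmix (p) : g (mix p) = shiftedCosMean ℓ ((Had ℓ).mulVec fun i => p.1 i * y i) w p.2 -
      exp (-(∑ i, w i ^ 2) / 2) * ((2 ^ ℓ : ℝ)⁻¹ *
        ∑ k, cos ((Had ℓ).mulVec (fun i => p.1 i * y i) k)) := by
    have h1 : (fun i => mix p i * y i) = fun i => p.1 i * y i := by
      funext i
      rcases hyw i with h | h <;> simp [hmix, h]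
    have h2 : (fun i => mix p i * (y + w) i) = (fun i => p.1 i * y i) + fun i => p.2 i * w i := by
      funext i
      rcases hyw i with h | h
      · by_cases h' : w i = 0 <;> simp [hmix, h, h']
      · simp [hmix, h]
    simp only [hg, shiftedCosMean, h1, h2, Matrix.mulVec_add, Pi.zero_apply, zero_add]
    rfl
  have hintmix : Integrable (fun p => exp (t * g (mix p))) (γ.prod γ) :=
    (integrable_map_measure (f := mix) (g := fun v => exp (t * g v))
      (by rw [hmap]; exact (hinteg t).aestronglyMeasurable) hmixmeas.aemeasurable).1
      (by rw [hmap]; exact hinteg t)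
  have hmgf : mgf g γ t = ∫ x, ∫ v, exp (t * g (mix (x, v))) ∂γ ∂γ := by
    rw [mgf, ← integral_prod (fun p => exp (t * g (mix p))) hintmix]
    conv_lhs => rw [← hmap]
    exact integral_map hmixmeas.aemeasurable (by rw [hmap]; exact (hinteg t).aestronglyMeasurable)
  rw [hmgf]
  refine (integral_mono hintmix.integral_prod_left (integrable_const _) fun x => ?_).trans_eq
    (by rw [integral_const, probReal_univ, one_smul])
  simp only [hgmix]
  exact (hasSubgaussianMGF_shiftedCosMean _ w hw).mgf_le t

end Block

section Tail

variable {ℓ m : ℕ}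

/-- The average of `cos (h̃_{j,k}(z))` over all `j` and `k`. -/
def cosMean (ℓ m : ℕ) (D : Fin m → Fin (2 ^ ℓ) → ℝ) (z : Fin (2 ^ ℓ) → ℝ) : ℝ :=
  (m : ℝ)⁻¹ * ∑ j, shiftedCosMean ℓ 0 z (D j)

instance isProbabilityMeasure_diagMeasure (ℓ m : ℕ) : IsProbabilityMeasure (diagMeasure ℓ m) := by
  unfold diagMeasure
  infer_instance

lemma cosMean_eq (D : Fin m → Fin (2 ^ ℓ) → ℝ) (z : EuclideanSpace ℝ (Fin (2 ^ ℓ))) :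
    1 / ((m : ℝ) * 2 ^ ℓ) * ∑ j, ∑ k, cos (rht ℓ m D z j k) = cosMean ℓ m D z.ofLp := by
  simp only [cosMean, shiftedCosMean, rht, Pi.zero_apply, zero_add, ← Finset.mul_sum]
  rw [one_div, mul_inv, mul_assoc]

lemma cosMean_zero (hm : 0 < m) (D : Fin m → Fin (2 ^ ℓ) → ℝ) : cosMean ℓ m D 0 = 1 := by
  have : (fun _ => 0 : Fin (2 ^ ℓ) → ℝ) = 0 := rfl
  simp [cosMean, shiftedCosMean, this, hm.ne']

/-- Tail bound for the multiplicative approximation of `cosMean` under adding a vector with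
disjoint support. -/
lemma measure_cosMean_add_le (hm : 0 < m) (y w : Fin (2 ^ ℓ) → ℝ)
    (hyw : ∀ i, y i = 0 ∨ w i = 0) {σ : ℝ} (hw : ∀ i, |w i| ≤ σ) {t : ℝ} (ht : 0 ≤ t) :
    (diagMeasure ℓ m).real {D | t ≤ |cosMean ℓ m D (y + w) -
        exp (-(∑ i, w i ^ 2) / 2) * cosMean ℓ m D y|} ≤
      2 * exp (-(2 * m * t ^ 2 / (π ^ 2 * σ ^ 2))) := by
  set g : (Fin (2 ^ ℓ) → ℝ) → ℝ := fun v => shiftedCosMean ℓ 0 (y + w) v -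
        exp (-(∑ i, w i ^ 2) / 2) * shiftedCosMean ℓ 0 y v with hg
  set c : ℝ≥0 := (π ^ 2 / 4 * σ ^ 2).toNNReal with hc
  have hcr : (c : ℝ) = π ^ 2 / 4 * σ ^ 2 := Real.coe_toNNReal _ (by positivity)
  have hsub : HasSubgaussianMGF g c (Measure.pi fun _ => gaussianReal 0 1) :=
    hasSubgaussianMGF_shiftedCosMean_add y w hyw hw
  have hind : iIndepFun (fun (j : Fin m) (D : Fin m → Fin (2 ^ ℓ) → ℝ) => g (D j))
      (diagMeasure ℓ m) := iIndepFun_pi fun _ => hsub.aemeasurable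
  have hblock (j : Fin m) : HasSubgaussianMGF (fun D : Fin m → Fin (2 ^ ℓ) → ℝ => g (D j)) c
      (diagMeasure ℓ m) := by
    have hmap : (diagMeasure ℓ m).map (fun D => D j) = Measure.pi fun _ => gaussianReal 0 1 :=
      (measurePreserving_eval (fun _ : Fin m => Measure.pi fun _ => gaussianReal 0 1) j).map_eq
    exact HasSubgaussianMGF.of_map (X := g) (Y := fun D : Fin m → Fin (2 ^ ℓ) → ℝ => D j)
      (measurable_pi_apply j).aemeasurable (by rwa [hmap])
  have hsum := HasSubgaussianMGF.sum_of_iIndepFun hind (s := Finset.univ) fun j _ => hblock j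
  have hmpos : (0 : ℝ) < m := by exact_mod_cast hm
  have hval (D : Fin m → Fin (2 ^ ℓ) → ℝ) : cosMean ℓ m D (y + w) -
      exp (-(∑ i, w i ^ 2) / 2) * cosMean ℓ m D y = (m : ℝ)⁻¹ * ∑ j, g (D j) := by
    simp only [cosMean, hg, Finset.sum_sub_distrib, ← Finset.mul_sum]
    ring
  have hset : {D | t ≤ |cosMean ℓ m D (y + w) -
        exp (-(∑ i, w i ^ 2) / 2) * cosMean ℓ m D y|} ⊆
      {D | m * t ≤ ∑ j, g (D j)} ∪ {D | m * t ≤ -∑ j, g (D j)} := by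
    intro D hD
    rw [Set.mem_ofPred_eq, hval, abs_mul, abs_of_pos (inv_pos.2 hmpos), le_inv_mul_iff₀ hmpos] at hD
    exact le_abs.1 hD
  have hexp : exp (-(m * t) ^ 2 / (2 * (∑ _j : Fin m, c : ℝ≥0))) =
      exp (-(2 * m * t ^ 2 / (π ^ 2 * σ ^ 2))) := by
    congr 1
    simp only [Finset.sum_const, Finset.card_univ, Fintype.card_fin, nsmul_eq_mul, NNReal.coe_mul,
      NNReal.coe_natCast, hcr]
    rcases eq_or_ne σ 0 with h | h
    · simp [h]
    · field_simp
      ring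
  have h1 := hsum.measure_ge_le (ε := m * t) (by positivity)
  have h2 := hsum.neg.measure_ge_le (ε := m * t) (by positivity)
  rw [hexp] at h1 h2
  calc _ ≤ _ := measureReal_mono hset
    _ ≤ _ := measureReal_union_le _ _
    _ ≤ _ := by rw [two_mul]; exact add_le_add h1 h2

lemma abs_cosMean_sub_le (D : Fin m → Fin (2 ^ ℓ) → ℝ) (z z' : Fin (2 ^ ℓ) → ℝ) {η : ℝ}
    (h : ∀ i, |z i - z' i| ≤ η) :
    |cosMean ℓ m D z - cosMean ℓ m D z'| ≤ (m : ℝ)⁻¹ * (∑ j, ∑ i, |D j i|) * η := by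
  rw [cosMean, cosMean, ← mul_sub, abs_mul, abs_of_nonneg (by positivity), mul_assoc,
    ← Finset.sum_sub_distrib, Finset.sum_mul]
  gcongr
  refine (Finset.abs_sum_le_sum_abs _ _).trans (Finset.sum_le_sum fun j _ => ?_)
  refine (abs_shiftedCosMean_sub_le 0 z (D j) z' (D j)).trans ?_
  rw [inv_mul_le_iff₀ (by positivity)]
  refine (Finset.sum_le_sum fun k _ => abs_Had_mulVec_le ℓ _ k).trans ?_
  rw [Finset.sum_const, Finset.card_univ, Fintype.card_fin, nsmul_eq_mul, Nat.cast_pow,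
    Nat.cast_ofNat, Finset.sum_mul]
  gcongr with i
  rw [← mul_sub, abs_mul]
  gcongr
  exact h i

lemma integral_abs_gaussianReal_le :
    Integrable (fun x : ℝ => |x|) (gaussianReal 0 1) ∧ ∫ x, |x| ∂(gaussianReal 0 1) ≤ 1 := by
  have hid : MemLp (fun x : ℝ => x) 2 (gaussianReal 0 1) := IsGaussian.memLp_two_fun_id
  have hsq : Integrable (fun x : ℝ => x ^ 2) (gaussianReal 0 1) := hid.integrable_sq
  have habs : Integrable (fun x : ℝ => |x|) (gaussianReal 0 1) :=
    (hid.integrable (by norm_num)).abs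
  refine ⟨habs, ?_⟩
  have hvar : ∫ x, x ^ 2 ∂(gaussianReal 0 1) = 1 := by
    have h := variance_fun_id_gaussianReal (μ := 0) (v := 1)
    rw [variance_of_integral_eq_zero (by fun_prop) (by simp)] at h
    simpa using h
  calc ∫ x, |x| ∂(gaussianReal 0 1) ≤ ∫ x, (x ^ 2 + 1) / 2 ∂(gaussianReal 0 1) :=
        integral_mono habs ((hsq.add (integrable_const _)).div_const _) fun x => by
          simp only
          nlinarith [sq_nonneg (|x| - 1), sq_abs x]
    _ = 1 := by
        rw [integral_div, integral_add hsq (integrable_const _), hvar]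
        simp

/-- Markov bound for the Lipschitz constant of `cosMean` with respect to the sup norm. -/
lemma measure_sum_abs_ge_le (hm : 0 < m) {s : ℝ} (hs : 0 < s) :
    (diagMeasure ℓ m).real {D | 2 ^ ℓ / s ≤ (m : ℝ)⁻¹ * ∑ j, ∑ i, |D j i|} ≤ s := by
  have hpres (j : Fin m) (i : Fin (2 ^ ℓ)) : MeasurePreserving
      (fun D : Fin m → Fin (2 ^ ℓ) → ℝ => D j i) (diagMeasure ℓ m) (gaussianReal 0 1) :=
    (measurePreserving_eval (fun _ : Fin (2 ^ ℓ) => gaussianReal 0 1) i).comp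
      (measurePreserving_eval (fun _ : Fin m => Measure.pi fun _ => gaussianReal 0 1) j)
  have hinteg (j : Fin m) (i : Fin (2 ^ ℓ)) :
      Integrable (fun D : Fin m → Fin (2 ^ ℓ) → ℝ => |D j i|) (diagMeasure ℓ m) :=
    (hpres j i).integrable_comp_of_integrable integral_abs_gaussianReal_le.1
  have hmean (j : Fin m) (i : Fin (2 ^ ℓ)) : ∫ D, |D j i| ∂(diagMeasure ℓ m) ≤ 1 := by
    rw [← integral_map (φ := fun D : Fin m → Fin (2 ^ ℓ) → ℝ => D j i) (f := fun x => |x|)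
      (hpres j i).measurable.aemeasurable (by fun_prop), (hpres j i).map_eq]
    exact integral_abs_gaussianReal_le.2
  have hmpos : (0 : ℝ) < m := by exact_mod_cast hm
  have hI : Integrable (fun D => (m : ℝ)⁻¹ * ∑ j, ∑ i, |D j i|) (diagMeasure ℓ m) :=
    (integrable_finsetSum _ fun j _ => integrable_finsetSum _ fun i _ => hinteg j i).const_mul _
  have hE : ∫ D, (m : ℝ)⁻¹ * ∑ j, ∑ i, |D j i| ∂(diagMeasure ℓ m) ≤ 2 ^ ℓ := by
    rw [integral_const_mul, integral_finsetSum _ fun j _ =>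
      integrable_finsetSum _ fun i _ => hinteg j i, inv_mul_le_iff₀ hmpos]
    calc _ ≤ ∑ _j : Fin m, ∑ _i : Fin (2 ^ ℓ), (1 : ℝ) := by
          refine Finset.sum_le_sum fun j _ => ?_
          rw [integral_finsetSum _ fun i _ => hinteg j i]
          exact Finset.sum_le_sum fun i _ => hmean j i
      _ = m * 2 ^ ℓ := by simp
  have hmarkov := mul_meas_ge_le_integral_of_nonneg
    (Filter.Eventually.of_forall fun D => by positivity) hI (2 ^ ℓ / s)
  have h2 := hmarkov.trans hE
  rw [div_mul_eq_mul_div, div_le_iff₀ hs] at h2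
  exact le_of_mul_le_mul_left h2 (by positivity)

end Tail

section Net

/-- Set to zero the coordinates of magnitude at most `r`. -/
def threshold {ι : Type*} (r : ℝ) (u : ι → ℝ) : ι → ℝ :=
  fun i => if r < |u i| then u i else 0

variable {ι : Type*}

lemma threshold_threshold {r s : ℝ} (h : s ≤ r) (u : ι → ℝ) :
    threshold r (threshold s u) = threshold r u := by
  funext i
  unfold threshold
  by_cases hs : s < |u i|
  · simp [hs]
  · have : ¬ r < |u i| := fun hr => hs (h.trans_lt hr)
    simp [hs, this]

lemma threshold_eq_zero_or (r : ℝ) (u : ι → ℝ) (i : ι) :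
    threshold r u i = 0 ∨ (u - threshold r u) i = 0 := by
  by_cases h : r < |u i| <;> simp [threshold, h]

lemma abs_sub_threshold_le {r : ℝ} (hr : 0 ≤ r) (u : ι → ℝ) (i : ι) :
    |(u - threshold r u) i| ≤ r := by
  by_cases h : r < |u i|
  · simpa [threshold, h] using hr
  · have h' := not_lt.1 h
    simpa [threshold, h] using h'

lemma threshold_sum_sq_add [Fintype ι] (r : ℝ) (u : ι → ℝ) :
    ∑ i, threshold r u i ^ 2 + ∑ i, (u - threshold r u) i ^ 2 = ∑ i, u i ^ 2 := by
  rw [← Finset.sum_add_distrib]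
  refine Finset.sum_congr rfl fun i _ => ?_
  by_cases h : r < |u i| <;> simp [threshold, h]

lemma card_support_threshold_le [Fintype ι] {r R : ℝ} (hr : 0 < r) (u : ι → ℝ)
    (hu : ∑ i, u i ^ 2 ≤ R ^ 2) :
    ((Finset.univ.filter fun i => threshold r u i ≠ 0).card : ℝ) ≤ R ^ 2 / r ^ 2 := by
  rw [le_div_iff₀ (by positivity)]
  refine le_trans ?_ hu
  rw [← nsmul_eq_mul, ← Finset.sum_const]
  refine (Finset.sum_le_sum fun i hi => ?_).trans
    (Finset.sum_le_sum_of_subset_of_nonneg (Finset.subset_univ _) fun i _ _ => sq_nonneg (u i))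
  have h : r < |u i| := by
    by_contra h
    simp [threshold, h] at hi
  rw [← sq_abs (u i)]
  gcongr

/-- Multiplicative one-step approximations along dyadic thresholds telescope. -/
lemma abs_sub_exp_threshold_le [Fintype ι] {F : (ι → ℝ) → ℝ} (hF : F 0 = 1) {R t : ℝ} (hR : 0 ≤ R)
    (u : ι → ℝ) (hu : ∀ i, |u i| ≤ R) (B : ℕ)
    (hstep : ∀ b < B, ∀ x, x = threshold (R / 2 ^ (b + 1)) u →
      |F x - exp (-(∑ i, (x - threshold (R / 2 ^ b) x) i ^ 2) / 2) * F (threshold (R / 2 ^ b) x)|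
        ≤ t) :
    |F (threshold (R / 2 ^ B) u) - exp (-(∑ i, threshold (R / 2 ^ B) u i ^ 2) / 2)| ≤ B * t := by
  induction B with
  | zero =>
    have h0 : threshold (R / 2 ^ 0) u = 0 := by
      funext i
      simp [threshold, hu i]
    rw [h0, hF]
    simp
  | succ B ih =>
    have ih := ih fun b hb => hstep b (hb.trans (Nat.lt_succ_self B))
    have h := hstep B (Nat.lt_succ_self B) _ rfl
    set x := threshold (R / 2 ^ (B + 1)) u with hx
    have hle : R / 2 ^ (B + 1) ≤ R / 2 ^ B := by
      gcongr
      · norm_num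
      · omega
    have hthr : threshold (R / 2 ^ B) x = threshold (R / 2 ^ B) u := threshold_threshold hle u
    have hsq := threshold_sum_sq_add (R / 2 ^ B) x
    rw [hthr] at h hsq
    set y := threshold (R / 2 ^ B) u
    set e := exp (-(∑ i, (x - y) i ^ 2) / 2) with he
    have hsplit : exp (-(∑ i, x i ^ 2) / 2) = e * exp (-(∑ i, y i ^ 2) / 2) := by
      rw [he, ← exp_add, ← hsq]
      ring_nf
    have he1 : e ≤ 1 := exp_le_one_iff.2 (by
      have := Finset.sum_nonneg fun i (_ : i ∈ Finset.univ) => sq_nonneg ((x - y) i)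
      linarith)
    have he2 : |e * (F y - exp (-(∑ i, y i ^ 2) / 2))| ≤ B * t := by
      rw [abs_mul, abs_of_pos (exp_pos _)]
      exact (mul_le_of_le_one_left (abs_nonneg _) he1).trans ih
    rw [hsplit]
    calc |F x - e * exp (-(∑ i, y i ^ 2) / 2)|
        = |(F x - e * F y) + e * (F y - exp (-(∑ i, y i ^ 2) / 2))| := by ring_nf
      _ ≤ t + B * t := (abs_add_le _ _).trans (add_le_add h he2)
      _ = ((B + 1 : ℕ) : ℝ) * t := by push_cast; ring

/-- Counting sparse vectors with entries in a finite set. -/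
lemma exists_finset_sparse [Fintype ι] [Nonempty ι] (V : Finset ℝ) (hV : 0 ∈ V) (s : ℕ) :
    ∃ T : Finset (ι → ℝ), T.card ≤ (Fintype.card ι * V.card) ^ s ∧
      ∀ u : ι → ℝ, (∀ i, u i ∈ V) → (Finset.univ.filter fun i => u i ≠ 0).card ≤ s → u ∈ T := by
  induction s with
  | zero =>
    refine ⟨{0}, by simp, fun u _ hs => ?_⟩
    rw [Finset.mem_singleton]
    funext i
    by_contra hi
    rw [Nat.le_zero, Finset.card_eq_zero] at hs
    have : i ∈ Finset.univ.filter fun i => u i ≠ 0 := by simpa using hi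
    simp [hs] at this
  | succ s ih =>
    obtain ⟨T, hcard, hT⟩ := ih
    refine ⟨(T ×ˢ (Finset.univ ×ˢ V)).image fun q => Function.update q.1 q.2.1 q.2.2, ?_, ?_⟩
    · refine Finset.card_image_le.trans ?_
      rw [Finset.card_product, Finset.card_product, Finset.card_univ, pow_succ]
      gcongr
    · intro u huV hs
      simp only [Finset.mem_image, Finset.mem_product, Finset.mem_univ, true_and, Prod.exists]
      obtain ⟨i, hi⟩ : ∃ i, u i = 0 → u = 0 := by
        by_cases h : ∃ i, u i ≠ 0
        · exact ⟨h.choose, fun h0 => absurd h0 h.choose_spec⟩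
        · push Not at h
          exact ⟨Classical.arbitrary ι, fun _ => funext h⟩
      refine ⟨Function.update u i 0, i, u i, ⟨hT _ (fun k => ?_) ?_, huV i⟩, by simp⟩
      · by_cases hk : k = i <;> simp [hk, hV, huV]
      · have hsub : (Finset.univ.filter fun k => Function.update u i 0 k ≠ 0) ⊆
            (Finset.univ.filter fun k => u k ≠ 0).erase i := by
          intro k
          by_cases hk : k = i <;> simp [Function.update_apply, hk]
        refine (Finset.card_le_card hsub).trans ?_
        by_cases h0 : u i = 0
        · simp [hi h0]
        · rw [Finset.card_erase_of_mem (by simpa using h0)]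
          omega

/-- A grid of mesh `η` in `[-R, R]`, with rounding towards zero. -/
lemma exists_grid {η R : ℝ} (hη : 0 < η) (K : ℕ) (hK : R ≤ K * η) :
    ∃ V : Finset ℝ, V.card ≤ 2 * K + 1 ∧ 0 ∈ V ∧ (∀ v ∈ V, v ≠ 0 → η ≤ |v|) ∧
      ∀ x, |x| ≤ R → ∃ v ∈ V, |v| ≤ |x| ∧ |x - v| ≤ η := by
  refine ⟨(Finset.Icc (-K : ℤ) K).image fun n : ℤ => η * n, ?_, ?_, ?_, ?_⟩
  · refine Finset.card_image_le.trans ?_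
    rw [Int.card_Icc]
    omega
  · exact Finset.mem_image.2 ⟨0, by simp, by simp⟩
  · intro v hv hv0
    obtain ⟨n, -, rfl⟩ := Finset.mem_image.1 hv
    have hn : n ≠ 0 := by
      rintro rfl
      simp at hv0
    have : (1 : ℝ) ≤ |(n : ℝ)| := by exact_mod_cast Int.one_le_abs hn
    rw [abs_mul, abs_of_pos hη]
    nlinarith
  · have hnonneg (x : ℝ) (hx0 : 0 ≤ x) (hx : x ≤ R) :
        ∃ n : ℤ, 0 ≤ n ∧ n ≤ K ∧ η * n ≤ x ∧ x - η * n ≤ η := by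
      have h1 := Int.floor_le (x / η)
      have h2 := (Int.lt_floor_add_one (x / η)).le
      rw [le_div_iff₀ hη] at h1
      rw [div_le_iff₀ hη] at h2
      refine ⟨⌊x / η⌋, Int.floor_nonneg.2 (by positivity), ?_, by linarith, by linarith⟩
      have : (⌊x / η⌋ : ℝ) ≤ K := le_of_mul_le_mul_right ((h1.trans hx).trans hK) hη
      exact_mod_cast this
    intro x hx
    obtain ⟨n, hn0, hnK, hle, hsub⟩ := hnonneg |x| (abs_nonneg x) hx
    have hn : (0 : ℝ) ≤ η * n := mul_nonneg hη.le (by exact_mod_cast hn0)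
    rcases abs_cases x with ⟨habs, -⟩ | ⟨habs, -⟩
    · refine ⟨η * n, Finset.mem_image.2 ⟨n, by simp; omega, rfl⟩, by rwa [abs_of_nonneg hn], ?_⟩
      rw [abs_le]
      constructor <;> linarith
    · refine ⟨η * (-n : ℤ), Finset.mem_image.2 ⟨-n, by simp; omega, rfl⟩, ?_, ?_⟩
      · push_cast
        rwa [mul_neg, abs_neg, abs_of_nonneg hn]
      · push_cast
        rw [abs_le]
        constructor <;> linarith

end Net

section Assembly

variable {ℓ m : ℕ}

/-- Failure of the one-step approximation at dyadic level `b` for some sparse vector with entries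
in `V`. -/
def badSet (ℓ m : ℕ) (V : Finset ℝ) (R t : ℝ) (b : ℕ) : Set (Fin m → Fin (2 ^ ℓ) → ℝ) :=
  {D | ∃ x : Fin (2 ^ ℓ) → ℝ, (∀ i, x i ∈ V) ∧
    (Finset.univ.filter fun i => x i ≠ 0).card ≤ 4 ^ (b + 1) ∧
    t ≤ |cosMean ℓ m D x - exp (-(∑ i, (x - threshold (R / 2 ^ b) x) i ^ 2) / 2) *
      cosMean ℓ m D (threshold (R / 2 ^ b) x)|}

lemma measure_badSet_le (hm : 0 < m) {V : Finset ℝ} (hV : 0 ∈ V) {R t : ℝ} (hR : 0 < R)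
    (ht : 0 ≤ t) (b : ℕ) :
    (diagMeasure ℓ m).real (badSet ℓ m V R t b) ≤
      2 * ((2 ^ ℓ * V.card : ℝ) ^ 4 * exp (-(2 * m * t ^ 2 / (π ^ 2 * R ^ 2)))) ^ 4 ^ b := by
  have : Nonempty (Fin (2 ^ ℓ)) := ⟨⟨0, by positivity⟩⟩
  obtain ⟨T, hcard, hT⟩ := exists_finset_sparse (ι := Fin (2 ^ ℓ)) V hV (4 ^ (b + 1))
  set κ := 2 * m * t ^ 2 / (π ^ 2 * R ^ 2) with hκ
  have hsub : badSet ℓ m V R t b ⊆ ⋃ x ∈ T, {D | t ≤ |cosMean ℓ m D x -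
      exp (-(∑ i, (x - threshold (R / 2 ^ b) x) i ^ 2) / 2) *
        cosMean ℓ m D (threshold (R / 2 ^ b) x)|} := by
    rintro D ⟨x, hxV, hxs, hx⟩
    exact Set.mem_biUnion (hT x hxV hxs) hx
  have hone (x : Fin (2 ^ ℓ) → ℝ) : (diagMeasure ℓ m).real {D | t ≤ |cosMean ℓ m D x -
      exp (-(∑ i, (x - threshold (R / 2 ^ b) x) i ^ 2) / 2) *
        cosMean ℓ m D (threshold (R / 2 ^ b) x)|} ≤ 2 * exp (-κ) ^ 4 ^ b := by
    have h := measure_cosMean_add_le (ℓ := ℓ) hm (threshold (R / 2 ^ b) x)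
      (x - threshold (R / 2 ^ b) x) (threshold_eq_zero_or _ x)
      (abs_sub_threshold_le (by positivity) x) ht
    rw [add_sub_cancel] at h
    refine h.trans_eq ?_
    rw [← exp_nat_mul, hκ]
    congr 2
    push_cast
    rw [show (4 : ℝ) ^ b = (2 ^ b) ^ 2 by rw [← pow_mul, mul_comm, pow_mul]; norm_num]
    field_simp
  calc (diagMeasure ℓ m).real (badSet ℓ m V R t b) ≤ _ := measureReal_mono hsub (measure_ne_top _ _)
    _ ≤ _ := measureReal_biUnion_finset_le _ _
    _ ≤ ∑ _x ∈ T, 2 * exp (-κ) ^ 4 ^ b := Finset.sum_le_sum fun x _ => hone x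
    _ = T.card * (2 * exp (-κ) ^ 4 ^ b) := by rw [Finset.sum_const, nsmul_eq_mul]
    _ ≤ (2 ^ ℓ * V.card : ℝ) ^ 4 ^ (b + 1) * (2 * exp (-κ) ^ 4 ^ b) := by
        gcongr
        have h : (T.card : ℝ) ≤ ((Fintype.card (Fin (2 ^ ℓ)) * V.card) ^ 4 ^ (b + 1) : ℕ) := by
          exact_mod_cast hcard
        simpa using h
    _ = _ := by
        rw [mul_pow, ← pow_mul, pow_succ, mul_comm (4 ^ b) 4]
        ring

lemma measure_iUnion_badSet_le (hm : 0 < m) {V : Finset ℝ} (hV : 0 ∈ V) {R t δ : ℝ} (hR : 0 < R)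
    (ht : 0 ≤ t) (hδ : 0 < δ) (hδ1 : δ ≤ 1) {B : ℕ} (hB : 0 < B)
    (hκ : (2 ^ ℓ * V.card : ℝ) ^ 4 * (8 * B / δ) ≤ exp (2 * m * t ^ 2 / (π ^ 2 * R ^ 2))) :
    (diagMeasure ℓ m).real (⋃ b ∈ Finset.range B, badSet ℓ m V R t b) ≤ δ / 4 := by
  set κ := 2 * m * t ^ 2 / (π ^ 2 * R ^ 2)
  set ρ := (2 ^ ℓ * V.card : ℝ) ^ 4 * exp (-κ) with hρ
  have hBr : (1 : ℝ) ≤ B := by exact_mod_cast hB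
  have hρle : ρ ≤ δ / (8 * B) := by
    rw [hρ, exp_neg, ← div_eq_mul_inv, div_le_iff₀ (exp_pos _), ← div_le_iff₀' (by positivity)]
    refine le_trans (le_of_eq ?_) hκ
    field_simp
  have hρ0 : 0 ≤ ρ := by positivity
  have hρ1 : ρ ≤ 1 := hρle.trans (by rw [div_le_one (by positivity)]; linarith)
  calc _ ≤ _ := measureReal_biUnion_finset_le _ _
    _ ≤ ∑ _b ∈ Finset.range B, 2 * (δ / (8 * B)) := by
        refine Finset.sum_le_sum fun b _ => (measure_badSet_le hm hV hR ht b).trans ?_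
        gcongr
        exact (pow_le_of_le_one hρ0 hρ1 (by positivity)).trans hρle
    _ = δ / 4 := by
        rw [Finset.sum_const, Finset.card_range, nsmul_eq_mul]
        field_simp
        norm_num

lemma abs_exp_neg_sub_exp_neg_le {a b : ℝ} (hb : 0 ≤ b) (hab : b ≤ a) :
    |exp (-b) - exp (-a)| ≤ a - b := by
  have h : exp (-a) = exp (-b) * exp (-(a - b)) := by rw [← exp_add]; ring_nf
  have h1 : exp (-b) ≤ 1 := exp_le_one_iff.2 (by linarith)
  have h2 := add_one_le_exp (-(a - b))
  have h3 : exp (-(a - b)) ≤ 1 := exp_le_one_iff.2 (by linarith)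
  rw [h, abs_of_nonneg (by nlinarith [exp_pos (-b)])]
  nlinarith [exp_pos (-b)]

/-- Off the bad sets, `cosMean` is close to the Gaussian expectation on the whole ball. -/
lemma abs_cosMean_sub_exp_le (hm : 0 < m) {V : Finset ℝ} {R t η A : ℝ} (hR : 0 < R) (hη : 0 < η)
    (hVη : ∀ v ∈ V, v ≠ 0 → η ≤ |v|)
    (hround : ∀ x, |x| ≤ R → ∃ v ∈ V, |v| ≤ |x| ∧ |x - v| ≤ η) (hV : 0 ∈ V) {B : ℕ}
    (hB : R / 2 ^ B < η) {D : Fin m → Fin (2 ^ ℓ) → ℝ}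
    (hD : ∀ b < B, D ∉ badSet ℓ m V R t b)
    (hA : (m : ℝ)⁻¹ * ∑ j, ∑ i, |D j i| ≤ A) (z : Fin (2 ^ ℓ) → ℝ) (hz : ∑ i, z i ^ 2 ≤ R ^ 2) :
    |cosMean ℓ m D z - exp (-((∑ i, z i ^ 2) / 2))| ≤ A * η + B * t + 2 ^ ℓ * (η * R) := by
  have hzR (i) : |z i| ≤ R := by
    refine abs_le_of_sq_le_sq' ?_ hR.le |> abs_le.2
    exact (Finset.single_le_sum (fun i _ => sq_nonneg (z i)) (Finset.mem_univ i)).trans hz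
  choose u huV hule huη using fun i => hround (z i) (hzR i)
  have husq : ∑ i, u i ^ 2 ≤ ∑ i, z i ^ 2 := Finset.sum_le_sum fun i _ => sq_le_sq.2 (hule i)
  have huthr : threshold (R / 2 ^ B) u = u := by
    funext i
    by_cases h0 : u i = 0
    · simp [threshold, h0]
    · simp [threshold, hB.trans_le (hVη _ (huV i) h0)]
  have hchain := abs_sub_exp_threshold_le (F := cosMean ℓ m D) (t := t) (cosMean_zero hm D) hR.le u
    (fun i => (hule i).trans (hzR i)) B (by
      rintro b hb x rfl
      by_contra hcon
      refine hD b hb ⟨_, fun i => ?_, ?_, (not_le.1 hcon).le⟩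
      · unfold threshold
        split_ifs
        exacts [huV i, hV]
      · have h := card_support_threshold_le (r := R / 2 ^ (b + 1)) (by positivity) u (husq.trans hz)
        have h4 : R ^ 2 / (R / 2 ^ (b + 1)) ^ 2 = ((4 ^ (b + 1) : ℕ) : ℝ) := by
          push_cast
          rw [show (4 : ℝ) ^ (b + 1) = (2 ^ (b + 1)) ^ 2 by
            rw [← pow_mul, mul_comm, pow_mul]; norm_num]
          field_simp
        rw [h4] at h
        exact_mod_cast h)
  rw [huthr, neg_div] at hchain
  have hlip : |cosMean ℓ m D z - cosMean ℓ m D u| ≤ A * η :=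
    (abs_cosMean_sub_le D z u huη).trans (by gcongr)
  have hexp : |exp (-((∑ i, u i ^ 2) / 2)) - exp (-((∑ i, z i ^ 2) / 2))| ≤ 2 ^ ℓ * (η * R) := by
    refine (abs_exp_neg_sub_exp_neg_le (by positivity) (by linarith)).trans ?_
    rw [← sub_div, ← Finset.sum_sub_distrib, div_le_iff₀ two_pos]
    calc ∑ i, (z i ^ 2 - u i ^ 2) ≤ ∑ _i : Fin (2 ^ ℓ), η * (2 * R) := by
          refine Finset.sum_le_sum fun i _ => ?_
          have h1 : |z i + u i| ≤ 2 * R :=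
            (abs_add_le _ _).trans (by linarith [hzR i, hule i])
          calc z i ^ 2 - u i ^ 2 = (z i - u i) * (z i + u i) := by ring
            _ ≤ |z i - u i| * |z i + u i| := by rw [← abs_mul]; exact le_abs_self _
            _ ≤ η * (2 * R) := by gcongr; exact huη i
      _ = 2 ^ ℓ * (η * R) * 2 := by simp; ring
  have htri := abs_add_three (cosMean ℓ m D z - cosMean ℓ m D u)
    (cosMean ℓ m D u - exp (-((∑ i, u i ^ 2) / 2)))
    (exp (-((∑ i, u i ^ 2) / 2)) - exp (-((∑ i, z i ^ 2) / 2)))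
  rw [sub_add_sub_cancel, sub_add_sub_cancel] at htri
  linarith

/-- The numerical choices: with `q = dR / (εδ)`, a grid of mesh `1 / (32 q)` and `⌈8 log q⌉` dyadic
levels, the sample size bound beats the union bound. -/
lemma pow_card_mul_le_exp {q R ε δ L d n B m : ℝ} (hq : q = d * R / (ε * δ)) (hL : L = log q)
    (hd : 1 ≤ d) (hR : 1 ≤ R) (hε : 0 < ε) (hε2 : ε < 1 / 2) (hδ : 0 < δ) (hδ2 : δ < 1 / 2)
    (hn0 : 0 ≤ n) (hn : n ≤ 2 * (32 * q * R + 1) + 1) (hB0 : 0 < B) (hB : B ≤ 8 * L + 1)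
    (hm : 300000 * ε⁻¹ ^ 2 * R ^ 2 * L ^ 3 ≤ m) :
    (d * n) ^ 4 * (8 * B / δ) ≤ exp (2 * m * (ε / (4 * B)) ^ 2 / (π ^ 2 * R ^ 2)) := by
  have hεδ : ε * δ ≤ 1 / 4 := by nlinarith
  have hεδ0 : 0 < ε * δ := by positivity
  have hdR : 1 ≤ d * R := one_le_mul_of_one_le_of_one_le hd hR
  have hqdR : 4 * (d * R) ≤ q := by
    rw [hq, le_div_iff₀ hεδ0]
    nlinarith
  have hq4 : 4 ≤ q := by linarith
  have hdq : d ≤ q := by nlinarith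
  have hRq : R ≤ q := by nlinarith
  have hδq : 1 / δ ≤ q := by
    rw [hq, div_le_div_iff₀ hδ hεδ0]
    nlinarith
  have hL1 : 1 ≤ L := by
    rw [hL, Real.le_log_iff_exp_le (by linarith)]
    linarith [Real.exp_one_lt_d9]
  have hLq : L ≤ q := by
    rw [hL]
    linarith [Real.log_le_sub_one_of_pos (show 0 < q by linarith)]
  have hq2 : 16 ≤ q ^ 2 := by nlinarith
  have hq4' : 256 ≤ q ^ 4 := by nlinarith
  have hnq : n ≤ q ^ 6 := by
    have h1 : q * R ≤ q ^ 2 := by nlinarith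
    have h2 : 256 * q ^ 2 ≤ q ^ 6 := by nlinarith
    linarith
  have hBq : 8 * B ≤ q ^ 5 := by
    have h1 : 256 * q ≤ q ^ 5 := by nlinarith
    linarith
  have hlhs : (d * n) ^ 4 * (8 * B / δ) ≤ q ^ 34 := by
    calc (d * n) ^ 4 * (8 * B / δ) = (d * n) ^ 4 * (8 * B * (1 / δ)) := by ring
      _ ≤ (q * q ^ 6) ^ 4 * (q ^ 5 * q) := by gcongr
      _ = q ^ 34 := by ring
  have hexpL : q ^ 34 = exp (34 * L) := by
    rw [hL, show (34 : ℝ) = ((34 : ℕ) : ℝ) by norm_num, exp_nat_mul, exp_log (by linarith)]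
  rw [hexpL] at hlhs
  refine hlhs.trans (exp_le_exp.2 ?_)
  have hπ : π ^ 2 ≤ 10 := by nlinarith [Real.pi_lt_d2, Real.pi_pos]
  have hB9 : B ^ 2 ≤ 81 * L ^ 2 := by nlinarith
  have hrw : 2 * m * (ε / (4 * B)) ^ 2 / (π ^ 2 * R ^ 2) =
      m * ε ^ 2 / (8 * B ^ 2 * π ^ 2 * R ^ 2) := by
    field_simp
    ring
  rw [hrw, le_div_iff₀ (by positivity)]
  have hmε : 300000 * R ^ 2 * L ^ 3 ≤ m * ε ^ 2 := by
    have h := mul_le_mul_of_nonneg_right hm (sq_nonneg ε)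
    refine le_trans (le_of_eq ?_) h
    field_simp
  have hBπ : B ^ 2 * π ^ 2 ≤ 81 * L ^ 2 * 10 := by gcongr
  calc 34 * L * (8 * B ^ 2 * π ^ 2 * R ^ 2) = 272 * L * R ^ 2 * (B ^ 2 * π ^ 2) := by ring
    _ ≤ 272 * L * R ^ 2 * (81 * L ^ 2 * 10) := by gcongr
    _ = 220320 * (R ^ 2 * L ^ 3) := by ring
    _ ≤ 300000 * (R ^ 2 * L ^ 3) := by gcongr; norm_num
    _ = 300000 * R ^ 2 * L ^ 3 := by ring
    _ ≤ m * ε ^ 2 := hmε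

lemma div_two_pow_lt {q R : ℝ} {B : ℕ} (hq : 4 ≤ q) (hR : R ≤ q) (hB : 8 * log q ≤ B) :
    R / 2 ^ B < 1 / (32 * q) := by
  have h2 : (2 : ℝ) ^ B = exp (B * log 2) := by rw [exp_nat_mul, exp_log two_pos]
  have hlog : 0 < log q := log_pos (by linarith)
  have h5 : q ^ 5 ≤ 2 ^ B := by
    have : q ^ 5 = exp (5 * log q) := by
      rw [show (5 : ℝ) = ((5 : ℕ) : ℝ) by norm_num, exp_nat_mul, exp_log (by linarith)]
    rw [this, h2, exp_le_exp]
    nlinarith [Real.log_two_gt_d9]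
  rw [div_lt_div_iff₀ (by positivity) (by linarith)]
  have h3 : 64 ≤ q ^ 3 := by nlinarith [sq_nonneg (q - 4)]
  have h6 : R * (32 * q) ≤ 32 * q ^ 2 := by nlinarith
  have h7 : 64 * q ^ 2 ≤ q ^ 5 := by nlinarith [sq_nonneg q]
  nlinarith

end Assembly

/-- Lemma 4.2: the difference cosine term concentrates uniformly
around its Gaussian expectation. -/
theorem cos_decomposition_second_term :
    ∃ C : ℝ, 0 < C ∧ ∃ c : ℕ, 0 < c ∧
      ∀ (ℓ : ℕ) (ε δ : ℝ), ε ∈ Set.Ioo (0 : ℝ) (1 / 2) → δ ∈ Set.Ioo (0 : ℝ) (1 / 2) →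
        ∀ W : Set (EuclideanSpace ℝ (Fin (2 ^ ℓ))), Bornology.IsBounded W →
          ∀ m : ℕ,
            C * ε⁻¹ ^ 2 * (1 + Metric.diam W) ^ 2 *
                Real.log (2 ^ ℓ * (1 + Metric.diam W) / (ε * δ)) ^ c ≤ (m : ℝ) →
            ENNReal.ofReal (1 - δ / 2) ≤
              diagMeasure ℓ m
                {D | ∀ x ∈ W, ∀ y ∈ W,
                  |(1 / ((m : ℝ) * 2 ^ ℓ)) * ∑ j, ∑ k, Real.cos (rht ℓ m D (x - y) j k) -
                      ∫ u, Real.cos u ∂(gaussianReal 0 (‖x - y‖₊ ^ 2))| ≤ ε / 2} := by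
  refine ⟨300000, by norm_num, 3, by norm_num, ?_⟩
  rintro ℓ ε δ ⟨hε, hε2⟩ ⟨hδ, hδ2⟩ W hW m hm
  set R := 1 + Metric.diam W with hRdef
  have hR : 1 ≤ R := le_add_of_nonneg_right Metric.diam_nonneg
  have hR0 : 0 < R := by linarith
  set q := 2 ^ ℓ * R / (ε * δ) with hq
  have hd : (1 : ℝ) ≤ 2 ^ ℓ := one_le_pow₀ (by norm_num)
  have hqdR : 4 * (2 ^ ℓ * R) ≤ q := by
    rw [hq, le_div_iff₀ (by positivity)]
    have : ε * δ ≤ 1 / 4 := by nlinarith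
    have : 0 < 2 ^ ℓ * R := by positivity
    nlinarith
  have hq4 : 4 ≤ q := by nlinarith
  have hRq : R ≤ q := by nlinarith
  have hL : 0 < log q := log_pos (by linarith)
  have hm0 : 0 < m := by
    have : (0 : ℝ) < m := lt_of_lt_of_le (by positivity) hm
    exact_mod_cast this
  set η := 1 / (32 * q) with hη
  have hη0 : 0 < η := by positivity
  set B := ⌈8 * log q⌉₊ with hBdef
  have hBle : 8 * log q ≤ B := Nat.le_ceil _
  have hB0 : 0 < B := Nat.ceil_pos.2 (by positivity)
  have hB0' : (0 : ℝ) < B := by exact_mod_cast hB0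
  have hBlt : (B : ℝ) ≤ 8 * log q + 1 := (Nat.ceil_lt_add_one (by positivity)).le
  set K := ⌈32 * q * R⌉₊ with hKdef
  have hKlt : (K : ℝ) ≤ 32 * q * R + 1 := (Nat.ceil_lt_add_one (by positivity)).le
  have hK : R ≤ K * η := by
    rw [hη, mul_one_div, le_div_iff₀ (by positivity)]
    calc R * (32 * q) = 32 * q * R := by ring
      _ ≤ K := Nat.le_ceil _
  obtain ⟨V, hVcard, hV0, hVη, hround⟩ := exists_grid hη0 K hK
  have hVcard' : (V.card : ℝ) ≤ 2 * (32 * q * R + 1) + 1 := by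
    have : (V.card : ℝ) ≤ ((2 * K + 1 : ℕ) : ℝ) := by exact_mod_cast hVcard
    push_cast at this
    linarith
  set t := ε / (4 * B) with ht
  set bad₁ : Set (Fin m → Fin (2 ^ ℓ) → ℝ) := ⋃ b ∈ Finset.range B, badSet ℓ m V R t b with hbad₁
  set bad₂ : Set (Fin m → Fin (2 ^ ℓ) → ℝ) :=
    {D | 2 ^ ℓ / (δ / 4) ≤ (m : ℝ)⁻¹ * ∑ j, ∑ i, |D j i|} with hbad₂
  have h₁ : (diagMeasure ℓ m).real bad₁ ≤ δ / 4 :=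
    measure_iUnion_badSet_le hm0 hV0 hR0 (by positivity) hδ (by linarith) hB0
      (pow_card_mul_le_exp hq rfl hd hR hε hε2 hδ hδ2 (by positivity) hVcard' hB0' hBlt hm)
  have h₂ : (diagMeasure ℓ m).real bad₂ ≤ δ / 4 := measure_sum_abs_ge_le hm0 (by positivity)
  set good := {D | ∀ x ∈ W, ∀ y ∈ W,
    |(1 / ((m : ℝ) * 2 ^ ℓ)) * ∑ j, ∑ k, Real.cos (rht ℓ m D (x - y) j k) -
      ∫ u, Real.cos u ∂(gaussianReal 0 (‖x - y‖₊ ^ 2))| ≤ ε / 2} with hgood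
  have hcover : Set.univ ⊆ good ∪ (bad₁ ∪ bad₂) := by
    intro D _
    by_contra hD
    simp only [Set.mem_union, not_or] at hD
    obtain ⟨hDgood, hD₁, hD₂⟩ := hD
    refine hDgood fun x hx y hy => ?_
    have hz : ∑ i, (x - y).ofLp i ^ 2 ≤ R ^ 2 := by
      rw [← EuclideanSpace.real_norm_sq_eq, ← dist_eq_norm]
      have := Metric.dist_le_diam_of_mem hW hx hy
      gcongr
      linarith
    have hgauss : ∫ u, Real.cos u ∂(gaussianReal 0 (‖x - y‖₊ ^ 2)) =
        exp (-((∑ i, (x - y).ofLp i ^ 2) / 2)) := by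
      have h := integral_cos_add_gaussianReal 0 (‖x - y‖₊ ^ 2)
      simp only [zero_add, cos_zero, mul_one] at h
      rw [h, NNReal.coe_pow, coe_nnnorm, EuclideanSpace.real_norm_sq_eq, neg_div]
    rw [cosMean_eq, hgauss]
    have hDb (b) (hb : b < B) : D ∉ badSet ℓ m V R t b := fun h =>
      hD₁ (Set.mem_biUnion (Finset.mem_coe.2 (Finset.mem_range.2 hb)) h)
    refine (abs_cosMean_sub_exp_le hm0 hR0 hη0 hVη hround hV0 (div_two_pow_lt hq4 hRq hBle) hDb
      (not_le.1 hD₂).le _ hz).trans ?_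
    have e₁ : 2 ^ ℓ / (δ / 4) * η ≤ ε / 8 := by
      have : 2 ^ ℓ / (δ / 4) * η = ε / (8 * R) := by
        rw [hη, hq]
        field_simp
        norm_num
      rw [this]
      gcongr
      linarith
    have e₂ : B * t = ε / 4 := by
      rw [ht]
      field_simp
    have e₃ : 2 ^ ℓ * (η * R) ≤ ε / 8 := by
      have : 2 ^ ℓ * (η * R) = ε * δ / 32 := by
        rw [hη, hq]
        field_simp
      rw [this]
      nlinarith
    linarith
  have htotal : 1 ≤ (diagMeasure ℓ m).real good + (δ / 4 + δ / 4) := by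
    calc (1 : ℝ) = (diagMeasure ℓ m).real Set.univ := probReal_univ.symm
      _ ≤ _ := measureReal_mono hcover
      _ ≤ _ := measureReal_union_le _ _
      _ ≤ _ := by
        gcongr
        exact (measureReal_union_le _ _).trans (add_le_add h₁ h₂)
  refine ENNReal.ofReal_le_of_le_toReal ?_
  change 1 - δ / 2 ≤ (diagMeasure ℓ m).real good
  linarith
end
end

section
/- Let d = 2^ℓ and ε, δ ∈ (0, 1/2), and let ψ_r(x) = min(|x|, r). There is an absolute constant C > 0 such that if m ≥ C ε⁻² log⁵(d/ε) log(1/δ), then with probability at least 1 − δ/4 over the random diagonal matrices, for every z ∈ ℝ^d with ‖z‖ = 1 and every r ≥ 4√(log(1/ε)): 1 − ε/2 ≤ (1/(md))·√(π/2)·Σ_{p=1}^m Σ_{q=1}^d ψ_r(h̃_{p,q}(z)) ≤ 1 + ε/2. -/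
open MeasureTheory ProbabilityTheory Real
open scoped ENNReal NNReal Classical

noncomputable section

/-- The standard Gaussian measure on `ι → ℝ`. -/
abbrev stdPi (ι : Type*) [Fintype ι] : Measure (ι → ℝ) := Measure.pi fun _ => gaussianReal 0 1

theorem map_linear_stdPi {ι : Type*} [Fintype ι] (c : ι → ℝ) :
    (stdPi ι).map (fun x => ∑ i, c i * x i) = gaussianReal 0 (∑ i, c i ^ 2).toNNReal := by
  refine Measure.ext_of_charFun ?_
  ext t
  have hm : Measurable (fun x : ι → ℝ => ∑ i, c i * x i) := by fun_prop
  rw [charFun_gaussianReal, charFun_apply_real, integral_map hm.aemeasurable (by fun_prop)]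
  have h1 : ∀ x : ι → ℝ, Complex.exp (t * (∑ i, c i * x i : ℝ) * Complex.I)
      = ∏ i, Complex.exp ((t * c i : ℝ) * x i * Complex.I) := by
    intro x
    rw [← Complex.exp_sum]
    congr 1
    push_cast
    rw [Finset.mul_sum, Finset.sum_mul]
    exact Finset.sum_congr rfl fun i _ => by ring
  simp_rw [h1]
  rw [integral_fintype_prod_eq_prod
    (f := fun i (x : ℝ) => Complex.exp ((t * c i : ℝ) * x * Complex.I))]
  simp_rw [← charFun_apply_real, charFun_gaussianReal]
  rw [← Complex.exp_sum, Real.coe_toNNReal _ (Finset.sum_nonneg fun i _ => sq_nonneg _)]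
  congr 1
  push_cast
  simp only [mul_zero, zero_mul, zero_sub, Finset.sum_mul, Finset.sum_div, Finset.sum_neg_distrib,
    one_mul]
  congr 1
  exact Finset.sum_congr rfl fun i _ => by ring

theorem lintegral_exp_linear_stdPi {ι : Type*} [Fintype ι] (c : ι → ℝ) :
    ∫⁻ x, ENNReal.ofReal (exp (∑ i, c i * x i)) ∂(stdPi ι)
      = ENNReal.ofReal (exp ((∑ i, c i ^ 2) / 2)) := by
  have hm : Measurable (fun x : ι → ℝ => ∑ i, c i * x i) := by fun_prop
  have h1 := lintegral_map (μ := stdPi ι) (f := fun t : ℝ => ENNReal.ofReal (exp t))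
    (by fun_prop) hm
  rw [← h1, map_linear_stdPi, ← ofReal_integral_eq_lintegral_ofReal]
  · have := congrFun (mgf_id_gaussianReal (μ := 0) (v := (∑ i, c i ^ 2).toNNReal)) 1
    simp only [mgf, id, one_mul] at this
    rw [this, Real.coe_toNNReal _ (Finset.sum_nonneg fun i _ => sq_nonneg _)]
    simp
  · simpa using integrable_exp_mul_gaussianReal (μ := 0) (v := (∑ i, c i ^ 2).toNNReal) 1
  · exact Filter.Eventually.of_forall fun x => (exp_pos _).le

/-- Rotation by the angle `θ` of the pairs `(x i, y i)`, `i ∈ S`. -/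
def rotOn {ι : Type*} (S : Finset ι) (θ : ℝ) (P : (ι → ℝ) × (ι → ℝ)) : (ι → ℝ) × (ι → ℝ) :=
  (fun i => if i ∈ S then cos θ * P.1 i + sin θ * P.2 i else P.1 i,
   fun i => if i ∈ S then -sin θ * P.1 i + cos θ * P.2 i else P.2 i)

theorem measurePreserving_rotOn {ι : Type*} [Fintype ι] (S : Finset ι) (θ : ℝ) :
    MeasurePreserving (rotOn S θ) ((stdPi ι).prod (stdPi ι)) ((stdPi ι).prod (stdPi ι)) := by
  have hrot : MeasurePreserving (ContinuousLinearMap.rotation (E := ℝ) θ)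
      ((gaussianReal 0 1).prod (gaussianReal 0 1)) ((gaussianReal 0 1).prod (gaussianReal 0 1)) :=
    ⟨(ContinuousLinearMap.rotation (E := ℝ) θ).continuous.measurable,
      IsGaussian.map_rotation_eq_self (by simp) θ⟩
  have hpi := measurePreserving_pi (ι := ι)
    (fun _ => (gaussianReal 0 1).prod (gaussianReal 0 1))
    (fun _ => (gaussianReal 0 1).prod (gaussianReal 0 1))
    (f := fun i => if i ∈ S then (ContinuousLinearMap.rotation (E := ℝ) θ) else id)
    (fun i => by split_ifs; exacts [hrot, MeasurePreserving.id _])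
  have he := measurePreserving_arrowProdEquivProdArrow ℝ ℝ ι
    (fun _ => gaussianReal 0 1) (fun _ => gaussianReal 0 1)
  have := (he.comp hpi).comp he.symm
  convert this using 1
  ext P i
  all_goals
    simp only [rotOn, Function.comp, MeasurableEquiv.arrowProdEquivProdArrow,
      Equiv.arrowProdEquivProdArrow, MeasurableEquiv.coe_mk, MeasurableEquiv.symm_mk]
    by_cases h : i ∈ S <;> simp [h, ContinuousLinearMap.rotation_apply]

/-- The Jensen inequality for `exp` along a differentiable path. -/
theorem exp_sub_le_average {Φ Φ' : ℝ → ℝ} (hΦ : ∀ θ, HasDerivAt Φ (Φ' θ) θ) (hc : Continuous Φ')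
    (c : ℝ) :
    exp (c * (Φ (π / 2) - Φ 0)) ≤
      (2 / π) * ∫ θ in Set.Ioc 0 (π / 2), exp (c * (π / 2) * Φ' θ) := by
  have hpi : (0 : ℝ) < π / 2 := by positivity
  have hftc : ∫ θ in (0 : ℝ)..(π / 2), Φ' θ = Φ (π / 2) - Φ 0 :=
    intervalIntegral.integral_eq_sub_of_hasDerivAt (fun θ _ => hΦ θ) (hc.intervalIntegrable _ _)
  have hJ := (convexOn_exp).map_set_average_le (μ := volume) (t := Set.Ioc 0 (π / 2))
    (f := fun θ => c * (π / 2) * Φ' θ) continuous_exp.continuousOn isClosed_univ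
    (by simp [pi_pos]) (by simp) (by simp)
    ((continuous_const.mul hc).integrableOn_Ioc)
    ((continuous_exp.comp (continuous_const.mul hc)).integrableOn_Ioc)
  rw [setAverage_eq, setAverage_eq] at hJ
  simp only [Measure.real, Real.volume_Ioc, sub_zero, ENNReal.toReal_ofReal hpi.le, smul_eq_mul,
    integral_const_mul] at hJ
  rw [← intervalIntegral.integral_of_le hpi.le, hftc] at hJ
  convert hJ using 2
  · field_simp
  · field_simp

section MaureyPisier

variable {ι κ : Type*} [Fintype ι] [Fintype κ] {φ φ' : ℝ → ℝ} {A B : κ → ι → ℝ} {S : Finset ι}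
  {L : ℝ}

/-- Decoupled exponential moment bound: resampling the coordinates in `S` of a standard Gaussian
vector changes a sum of Lipschitz functions of linear forms by a subgaussian amount. -/
theorem lintegral_exp_resample_le (hφ : ∀ x, HasDerivAt φ (φ' x) x) (hφc : Continuous φ')
    (hφb : ∀ x, |φ' x| ≤ 1) (hA : ∀ q, ∀ i ∈ S, A q i = 0) (hB : ∀ q, ∀ i ∉ S, B q i = 0)
    (hL : ∀ c : κ → ℝ, (∀ q, |c q| ≤ 1) → ∑ i, (∑ q, c q * B q i) ^ 2 ≤ L) (t : ℝ) :
    ∫⁻ P, ENNReal.ofReal (exp (t * (∑ q, φ (∑ i, A q i * P.1 i + ∑ i, B q i * P.2 i)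
        - ∑ q, φ (∑ i, A q i * P.1 i + ∑ i, B q i * P.1 i)))) ∂((stdPi ι).prod (stdPi ι))
      ≤ ENNReal.ofReal (exp (t ^ 2 * π ^ 2 / 8 * L)) := by
  set K : (ι → ℝ) × (ι → ℝ) → ℝ := fun P =>
    ∑ q, φ' (∑ i, A q i * P.1 i + ∑ i, B q i * P.1 i) * ∑ i, B q i * P.2 i with hK
  have hKc : Continuous K := by fun_prop
  have hu : ∀ q θ (P : (ι → ℝ) × (ι → ℝ)),
      ∑ i, A q i * (rotOn S θ P).1 i = ∑ i, A q i * P.1 i := by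
    intro q θ P
    refine Finset.sum_congr rfl fun i _ => ?_
    by_cases h : i ∈ S
    · simp [hA q i h]
    · simp [rotOn, h]
  have hv1 : ∀ q θ (P : (ι → ℝ) × (ι → ℝ)), ∑ i, B q i * (rotOn S θ P).1 i
      = cos θ * ∑ i, B q i * P.1 i + sin θ * ∑ i, B q i * P.2 i := by
    intro q θ P
    rw [Finset.mul_sum, Finset.mul_sum, ← Finset.sum_add_distrib]
    refine Finset.sum_congr rfl fun i _ => ?_
    by_cases h : i ∈ S
    · simp [rotOn, h]; ring
    · simp [hB q i h]
  have hv2 : ∀ q θ (P : (ι → ℝ) × (ι → ℝ)), ∑ i, B q i * (rotOn S θ P).2 i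
      = -sin θ * ∑ i, B q i * P.1 i + cos θ * ∑ i, B q i * P.2 i := by
    intro q θ P
    rw [Finset.mul_sum, Finset.mul_sum, ← Finset.sum_add_distrib]
    refine Finset.sum_congr rfl fun i _ => ?_
    by_cases h : i ∈ S
    · simp [rotOn, h]; ring
    · simp [hB q i h]
  have hKrot : ∀ θ P, K (rotOn S θ P) = ∑ q, φ' (∑ i, A q i * P.1 i +
      (cos θ * ∑ i, B q i * P.1 i + sin θ * ∑ i, B q i * P.2 i)) *
        (-sin θ * ∑ i, B q i * P.1 i + cos θ * ∑ i, B q i * P.2 i) := by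
    intro θ P
    simp only [hK, hu, hv1, hv2]
  have hpath : ∀ P : (ι → ℝ) × (ι → ℝ), ENNReal.ofReal (exp (t * (∑ q,
      φ (∑ i, A q i * P.1 i + ∑ i, B q i * P.2 i)
        - ∑ q, φ (∑ i, A q i * P.1 i + ∑ i, B q i * P.1 i)))) ≤
      ENNReal.ofReal (2 / π) * ∫⁻ θ in Set.Ioc 0 (π / 2),
        ENNReal.ofReal (exp (t * (π / 2) * K (rotOn S θ P))) := by
    intro P
    have hd : ∀ θ, HasDerivAt (fun θ => ∑ q, φ (∑ i, A q i * P.1 i +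
        (cos θ * ∑ i, B q i * P.1 i + sin θ * ∑ i, B q i * P.2 i))) (K (rotOn S θ P)) θ := by
      intro θ
      rw [hKrot]
      refine HasDerivAt.fun_sum fun q _ => ?_
      refine (hφ _).comp θ ?_
      exact (((hasDerivAt_cos θ).mul_const _).add ((hasDerivAt_sin θ).mul_const _)).const_add _
    have hc : Continuous fun θ => K (rotOn S θ P) := by
      simp only [hKrot]
      fun_prop
    have h := exp_sub_le_average hd hc t
    simp only [cos_pi_div_two, sin_pi_div_two, cos_zero, sin_zero, zero_mul, one_mul, zero_add,
      add_zero] at h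
    refine (ENNReal.ofReal_le_ofReal h).trans ?_
    rw [ENNReal.ofReal_mul (by positivity), ofReal_integral_eq_lintegral_ofReal]
    · exact (continuous_exp.comp (continuous_const.mul hc)).integrableOn_Ioc
    · exact Filter.Eventually.of_forall fun x => (exp_pos _).le
  have hbound : ∫⁻ P, ENNReal.ofReal (exp (t * (π / 2) * K P)) ∂((stdPi ι).prod (stdPi ι))
      ≤ ENNReal.ofReal (exp (t ^ 2 * π ^ 2 / 8 * L)) := by
    rw [lintegral_prod _ (by fun_prop)]
    have hin : ∀ x : ι → ℝ, ∫⁻ y, ENNReal.ofReal (exp (t * (π / 2) * K (x, y))) ∂(stdPi ι)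
        ≤ ENNReal.ofReal (exp (t ^ 2 * π ^ 2 / 8 * L)) := by
      intro x
      set c : κ → ℝ := fun q => φ' (∑ i, A q i * x i + ∑ i, B q i * x i) with hcdef
      have h1 : ∀ y : ι → ℝ, t * (π / 2) * K (x, y)
          = ∑ i, (t * (π / 2) * ∑ q, c q * B q i) * y i := by
        intro y
        simp only [hK, Finset.mul_sum, Finset.sum_mul]
        rw [Finset.sum_comm]
        refine Finset.sum_congr rfl fun i _ => Finset.sum_congr rfl fun q _ => ?_
        simp only [hcdef]; ring
      simp_rw [h1]
      rw [lintegral_exp_linear_stdPi]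
      refine ENNReal.ofReal_le_ofReal (exp_le_exp.mpr ?_)
      have h2 := hL c fun q => hφb _
      have h3 : (∑ i, (t * (π / 2) * ∑ q, c q * B q i) ^ 2) / 2
          = t ^ 2 * π ^ 2 / 8 * ∑ i, (∑ q, c q * B q i) ^ 2 := by
        simp only [mul_pow, ← Finset.mul_sum]; ring
      rw [h3]
      exact mul_le_mul_of_nonneg_left h2 (by positivity)
    calc _ ≤ ∫⁻ _, ENNReal.ofReal (exp (t ^ 2 * π ^ 2 / 8 * L)) ∂(stdPi ι) := lintegral_mono hin
      _ = _ := by simp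
  have hjoint : Measurable (Function.uncurry fun (P : (ι → ℝ) × (ι → ℝ)) (θ : ℝ) =>
      ENNReal.ofReal (exp (t * (π / 2) * K (rotOn S θ P)))) := by
    simp only [hKrot, Function.uncurry_def]
    fun_prop
  calc _ ≤ ∫⁻ P, ENNReal.ofReal (2 / π) * (∫⁻ θ in Set.Ioc 0 (π / 2),
        ENNReal.ofReal (exp (t * (π / 2) * K (rotOn S θ P)))) ∂((stdPi ι).prod (stdPi ι)) :=
        lintegral_mono hpath
    _ = ENNReal.ofReal (2 / π) * ∫⁻ θ in Set.Ioc 0 (π / 2), ∫⁻ P,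
        ENNReal.ofReal (exp (t * (π / 2) * K (rotOn S θ P))) ∂((stdPi ι).prod (stdPi ι)) := by
        rw [lintegral_const_mul' _ _ ENNReal.ofReal_ne_top,
          lintegral_lintegral_swap hjoint.aemeasurable]
    _ ≤ ENNReal.ofReal (2 / π) * ∫⁻ θ in Set.Ioc 0 (π / 2),
        ENNReal.ofReal (exp (t ^ 2 * π ^ 2 / 8 * L)) := by
        gcongr with θ
        have := (measurePreserving_rotOn (ι := ι) S θ).lintegral_comp
          (f := fun P => ENNReal.ofReal (exp (t * (π / 2) * K P))) (by fun_prop)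
        rw [this]
        exact hbound
    _ = _ := by
        rw [setLIntegral_const, Real.volume_Ioc, sub_zero, mul_left_comm,
          ← ENNReal.ofReal_mul (by positivity)]
        have : 2 / π * (π / 2) = 1 := by field_simp
        simp [this]

end MaureyPisier

/-- Bounded, continuously differentiable, `1`-Lipschitz functions. -/
structure SmoothBounded (φ : ℝ → ℝ) : Prop where
  differentiable : Differentiable ℝ φ
  continuous_deriv : Continuous (deriv φ)
  abs_deriv_le : ∀ x, |deriv φ x| ≤ 1
  bounded : ∃ b, ∀ x, |φ x| ≤ b

/-- The average of `φ` against a centred Gaussian of variance `v`. -/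
def gaussSmooth (φ : ℝ → ℝ) (v : ℝ≥0) (x : ℝ) : ℝ := ∫ t, φ (x + t) ∂gaussianReal 0 v

theorem abs_gaussSmooth_le {φ : ℝ → ℝ} {b : ℝ} (hb : ∀ x, |φ x| ≤ b) (v : ℝ≥0) (x : ℝ) :
    |gaussSmooth φ v x| ≤ b := by
  have := norm_integral_le_of_norm_le_const (μ := gaussianReal 0 v)
    (f := fun t => φ (x + t)) (C := b) (Filter.Eventually.of_forall fun t => hb _)
  simpa [gaussSmooth] using this

namespace SmoothBounded

variable {φ : ℝ → ℝ}

theorem continuous (h : SmoothBounded φ) : Continuous φ := h.differentiable.continuous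

theorem abs_sub_le (h : SmoothBounded φ) (x y : ℝ) : |φ x - φ y| ≤ |x - y| := by
  have := Convex.norm_image_sub_le_of_norm_deriv_le (f := φ) (s := Set.univ) (C := 1) (x := y)
    (y := x) (fun z _ => h.differentiable z) (fun z _ => h.abs_deriv_le z) convex_univ
    (Set.mem_univ _) (Set.mem_univ _)
  simpa using this

theorem integrable_comp (h : SmoothBounded φ) {Ω : Type*} [MeasurableSpace Ω] {μ : Measure Ω}
    [IsFiniteMeasure μ] {f : Ω → ℝ} (hf : Measurable f) : Integrable (fun ω => φ (f ω)) μ := by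
  obtain ⟨b, hb⟩ := h.bounded
  exact Integrable.of_bound (h.continuous.measurable.comp hf).aestronglyMeasurable b
    (Filter.Eventually.of_forall fun ω => hb _)

theorem gauss (h : SmoothBounded φ) (v : ℝ≥0) : SmoothBounded (gaussSmooth φ v) := by
  have hd : ∀ x, HasDerivAt (gaussSmooth φ v) (∫ t, deriv φ (x + t) ∂gaussianReal 0 v) x := by
    intro x
    refine (hasDerivAt_integral_of_dominated_loc_of_deriv_le (μ := gaussianReal 0 v)
      (F := fun x t => φ (x + t)) (F' := fun x t => deriv φ (x + t)) (s := Set.univ)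
      (bound := fun _ => 1) Filter.univ_mem ?_ ?_ ?_ ?_ (integrable_const _) ?_).2
    · exact Filter.Eventually.of_forall fun y =>
        (h.continuous.comp (continuous_const.add continuous_id)).aestronglyMeasurable
    · exact h.integrable_comp (measurable_const.add measurable_id)
    · exact (h.continuous_deriv.comp (continuous_const.add continuous_id)).aestronglyMeasurable
    · exact Filter.Eventually.of_forall fun t y _ => h.abs_deriv_le _
    · exact Filter.Eventually.of_forall fun t y _ =>
        (h.differentiable (y + t)).hasDerivAt.comp_add_const y t
  have hd' : deriv (gaussSmooth φ v) = fun x => ∫ t, deriv φ (x + t) ∂gaussianReal 0 v :=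
    funext fun x => (hd x).deriv
  refine ⟨fun x => (hd x).differentiableAt, ?_, ?_, ?_⟩
  · rw [hd']
    refine continuous_of_dominated (bound := fun _ => 1) ?_ ?_ (integrable_const _) ?_
    · exact fun x =>
        (h.continuous_deriv.comp (continuous_const.add continuous_id)).aestronglyMeasurable
    · exact fun x => Filter.Eventually.of_forall fun t => h.abs_deriv_le _
    · exact Filter.Eventually.of_forall fun t =>
        h.continuous_deriv.comp (continuous_id.add continuous_const)
  · intro x
    rw [hd']
    have := norm_integral_le_of_norm_le_const (μ := gaussianReal 0 v)
      (f := fun t => deriv φ (x + t)) (C := 1)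
      (Filter.Eventually.of_forall fun t => h.abs_deriv_le _)
    simpa using this
  · obtain ⟨b, hb⟩ := h.bounded
    exact ⟨b, abs_gaussSmooth_le hb v⟩

theorem gaussSmooth_gaussSmooth (h : SmoothBounded φ) (v w : ℝ≥0) :
    gaussSmooth (gaussSmooth φ v) w = gaussSmooth φ (w + v) := by
  ext x
  have hconv := gaussianReal_conv_gaussianReal (m₁ := 0) (m₂ := 0) (v₁ := w) (v₂ := v)
  rw [add_zero] at hconv
  rw [gaussSmooth, gaussSmooth, ← hconv, integral_conv]
  · simp only [gaussSmooth, add_assoc]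
  · exact h.integrable_comp (measurable_const.add measurable_id)

end SmoothBounded

theorem gaussSmooth_zero (φ : ℝ → ℝ) : gaussSmooth φ 0 = φ := by
  ext x
  simp [gaussSmooth, gaussianReal_zero_var]

section

variable {ι κ : Type*} [Fintype ι] [Fintype κ] {φ : ℝ → ℝ} {A B : κ → ι → ℝ} {S : Finset ι}

theorem hasSubgaussianMGF_sub_gaussSmooth (hφ : SmoothBounded φ)
    (hA : ∀ q, ∀ i ∈ S, A q i = 0) (hB : ∀ q, ∀ i ∉ S, B q i = 0) {L : ℝ≥0}
    (hL : ∀ c : κ → ℝ, (∀ q, |c q| ≤ 1) → ∑ i, (∑ q, c q * B q i) ^ 2 ≤ L)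
    {v : ℝ≥0} (hv : ∀ q, ∑ i, B q i ^ 2 = v) :
    HasSubgaussianMGF (fun x => ∑ q, gaussSmooth φ v (∑ i, A q i * x i)
        - ∑ q, φ (∑ i, A q i * x i + ∑ i, B q i * x i))
      (NNReal.pi ^ 2 / 4 * L) (stdPi ι) := by
  set μ := stdPi ι
  set F : (ι → ℝ) → (ι → ℝ) → ℝ :=
    fun x y => ∑ q, φ (∑ i, A q i * x i + ∑ i, B q i * y i) with hF
  have hφc := hφ.continuous
  have hFc : Continuous (Function.uncurry F) := by
    simp only [hF, Function.uncurry_def]; fun_prop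
  obtain ⟨b, hb⟩ := hφ.bounded
  have hb0 : 0 ≤ b := (abs_nonneg _).trans (hb 0)
  have hFb : ∀ x y, |F x y| ≤ Fintype.card κ * b := fun x y =>
    (Finset.abs_sum_le_sum_abs _ _).trans
      ((Finset.sum_le_sum fun q _ => hb _).trans (by simp))
  have hGb : ∀ x : ι → ℝ,
      |∑ q, gaussSmooth φ v (∑ i, A q i * x i)| ≤ Fintype.card κ * b := fun x =>
    (Finset.abs_sum_le_sum_abs _ _).trans
      ((Finset.sum_le_sum fun q _ => abs_gaussSmooth_le hb v _).trans (by simp))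
  have hFint : ∀ x, Integrable (F x) μ := fun x =>
    Integrable.of_bound (by fun_prop) _ (Filter.Eventually.of_forall fun y => hFb x y)
  have hmean : ∀ x, ∫ y, F x y ∂μ = ∑ q, gaussSmooth φ v (∑ i, A q i * x i) := by
    intro x
    simp only [hF]
    rw [integral_finsetSum _ fun q _ => hφ.integrable_comp (by fun_prop)]
    refine Finset.sum_congr rfl fun q _ => ?_
    have hmap := map_linear_stdPi (B q)
    rw [hv q, Real.toNNReal_coe] at hmap
    rw [gaussSmooth, ← hmap, integral_map (Measurable.aemeasurable (by fun_prop)) (by fun_prop)]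
  have hXc : Continuous fun x : ι → ℝ => ∑ q, gaussSmooth φ v (∑ i, A q i * x i)
        - ∑ q, φ (∑ i, A q i * x i + ∑ i, B q i * x i) := by
    have := (hφ.gauss v).continuous
    fun_prop
  have hint : ∀ t : ℝ, Integrable (fun x : ι → ℝ =>
      exp (t * (∑ q, gaussSmooth φ v (∑ i, A q i * x i) - F x x))) μ := by
    intro t
    refine Integrable.of_bound (C := exp (|t| * (2 * (Fintype.card κ * b))))
      (by
        simp only [hF]
        exact (continuous_exp.comp (continuous_const.mul hXc)).aestronglyMeasurable)
      (Filter.Eventually.of_forall fun x => ?_)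
    rw [Real.norm_eq_abs, abs_exp]
    refine exp_le_exp.mpr ((le_abs_self _).trans ?_)
    rw [abs_mul]
    refine mul_le_mul_of_nonneg_left ?_ (abs_nonneg _)
    have h1 := hGb x
    have h2 := hFb x x
    exact (abs_sub _ _).trans (by linarith)
  refine ⟨hint, fun t => ?_⟩
  have hmain := lintegral_exp_resample_le (φ := φ) (S := S) (L := L)
    (fun x => (hφ.differentiable x).hasDerivAt) hφ.continuous_deriv hφ.abs_deriv_le hA hB hL t
  rw [lintegral_prod _ (by fun_prop)] at hmain
  have hJ : ∀ x, ENNReal.ofReal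
      (exp (t * (∑ q, gaussSmooth φ v (∑ i, A q i * x i) - F x x))) ≤
      ∫⁻ y, ENNReal.ofReal (exp (t * (F x y - F x x))) ∂μ := by
    intro x
    have hi1 : Integrable (fun y => t * (F x y - F x x)) μ :=
      ((hFint x).sub (integrable_const _)).const_mul t
    have hi2 : Integrable (fun y => exp (t * (F x y - F x x))) μ := by
      refine Integrable.of_bound (C := exp (|t| * (2 * (Fintype.card κ * b)))) (by fun_prop)
        (Filter.Eventually.of_forall fun y => ?_)
      rw [Real.norm_eq_abs, abs_exp]
      refine exp_le_exp.mpr ((le_abs_self _).trans ?_)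
      rw [abs_mul]
      refine mul_le_mul_of_nonneg_left ?_ (abs_nonneg _)
      have h1 := hFb x y
      have h2 := hFb x x
      exact (abs_sub _ _).trans (by linarith)
    have h := convexOn_exp.map_integral_le (μ := μ) continuous_exp.continuousOn isClosed_univ
      (by simp) hi1 hi2
    rw [integral_const_mul, integral_sub (hFint x) (integrable_const _), hmean] at h
    simp only [integral_const, probReal_univ, one_smul] at h
    rw [← ofReal_integral_eq_lintegral_ofReal hi2
      (Filter.Eventually.of_forall fun y => (exp_pos _).le)]
    exact ENNReal.ofReal_le_ofReal h
  have h := (lintegral_mono hJ).trans hmain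
  rw [← ofReal_integral_eq_lintegral_ofReal (hint t)
      (Filter.Eventually.of_forall fun y => (exp_pos _).le),
    ENNReal.ofReal_le_ofReal_iff (exp_pos _).le] at h
  refine h.trans_eq ?_
  congr 1
  push_cast
  rw [NNReal.coe_real_pi]
  ring

end

/-- Matrices with entries `±1` and orthogonal rows. -/
structure IsHadamardMatrix {ι : Type*} [Fintype ι] (H : Matrix ι ι ℝ) : Prop where
  sq_eq_one : ∀ q i, H q i ^ 2 = 1
  mul_transpose : H * H.transpose = (Fintype.card ι : ℝ) • 1

/-- The empirical average of `φ` over the entries of the transforms `H * diag (D p) * w`. -/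
def transformAvg {ι : Type*} [Fintype ι] (H : Matrix ι ι ℝ) {m : ℕ} (φ : ℝ → ℝ) (w : ι → ℝ)
    (D : Fin m → ι → ℝ) : ℝ :=
  1 / (m * Fintype.card ι) * ∑ p, ∑ q, φ (∑ i, H q i * (D p i * w i))

section

variable {ι : Type*} [Fintype ι] {H : Matrix ι ι ℝ}

theorem IsHadamardMatrix.sum_sq_le (hH : IsHadamardMatrix H) {b : ι → ℝ} {β : ℝ}
    (hb : ∀ i, |b i| ≤ β) (c : ι → ℝ) (hc : ∀ q, |c q| ≤ 1) :
    ∑ i, (∑ q, c q * (H q i * b i)) ^ 2 ≤ β ^ 2 * (Fintype.card ι : ℝ) ^ 2 := by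
  have h1 : ∑ i, (∑ q, c q * H q i) ^ 2 = Fintype.card ι * ∑ q, c q ^ 2 := by
    have : (Matrix.vecMul c H) ⬝ᵥ (Matrix.vecMul c H) = Fintype.card ι * (c ⬝ᵥ c) := by
      rw [← Matrix.dotProduct_mulVec, ← Matrix.mulVec_transpose, Matrix.mulVec_mulVec,
        hH.mul_transpose, Matrix.smul_mulVec, Matrix.one_mulVec, dotProduct_smul, smul_eq_mul]
    simpa [dotProduct, Matrix.vecMul, pow_two] using this
  have h2 : ∑ q, c q ^ 2 ≤ Fintype.card ι := by
    calc ∑ q, c q ^ 2 ≤ ∑ _q : ι, (1 : ℝ) :=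
          Finset.sum_le_sum fun q _ => (sq_le_one_iff_abs_le_one _).mpr (hc q)
      _ = _ := by simp
  calc ∑ i, (∑ q, c q * (H q i * b i)) ^ 2 = ∑ i, b i ^ 2 * (∑ q, c q * H q i) ^ 2 := by
        refine Finset.sum_congr rfl fun i _ => ?_
        rw [← mul_pow, Finset.mul_sum]
        congr 1
        exact Finset.sum_congr rfl fun q _ => by ring
    _ ≤ ∑ i, β ^ 2 * (∑ q, c q * H q i) ^ 2 := by
        refine Finset.sum_le_sum fun i _ => mul_le_mul_of_nonneg_right ?_ (sq_nonneg _)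
        exact sq_le_sq' (abs_le.mp (hb i)).1 (abs_le.mp (hb i)).2
    _ = β ^ 2 * (Fintype.card ι * ∑ q, c q ^ 2) := by rw [← Finset.mul_sum, h1]
    _ ≤ _ := by
        rw [pow_two (Fintype.card ι : ℝ)]
        gcongr

theorem measure_transformAvg_sub_gaussSmooth_ge_le [Nonempty ι] (hH : IsHadamardMatrix H)
    {φ : ℝ → ℝ} (hφ : SmoothBounded φ) {m : ℕ} (hm : 0 < m) {w : ι → ℝ} {S : Finset ι} {β : ℝ}
    (hβ : 0 < β) (hw : ∀ i ∈ S, |w i| ≤ β) {v : ℝ≥0} (hv : (v : ℝ) = ∑ i ∈ S, w i ^ 2)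
    {τ : ℝ} (hτ : 0 ≤ τ) :
    (Measure.pi fun _ : Fin m => stdPi ι) {D | τ ≤ |transformAvg H φ w D -
        transformAvg H (gaussSmooth φ v) (fun i => if i ∈ S then 0 else w i) D|} ≤
      ENNReal.ofReal (2 * exp (-(τ ^ 2 * m / (5 * β ^ 2)))) := by
  set d : ℝ := (Fintype.card ι : ℝ) with hd
  have hd0 : 0 < d := by simp [hd, Fintype.card_pos]
  have hm0 : (0 : ℝ) < m := by exact_mod_cast hm
  set A : ι → ι → ℝ := fun q i => H q i * (if i ∈ S then 0 else w i) with hA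
  set B : ι → ι → ℝ := fun q i => H q i * (if i ∈ S then w i else 0) with hB
  set X : (ι → ℝ) → ℝ := fun x => ∑ q, gaussSmooth φ v (∑ i, A q i * x i)
        - ∑ q, φ (∑ i, A q i * x i + ∑ i, B q i * x i) with hX
  have hsub : HasSubgaussianMGF X (NNReal.pi ^ 2 / 4 * (β ^ 2 * d ^ 2).toNNReal) (stdPi ι) := by
    refine hasSubgaussianMGF_sub_gaussSmooth (S := S) hφ ?_ ?_ ?_ ?_
    · intro q i hi; simp [hA, hi]
    · intro q i hi; simp [hB, hi]
    · intro c hc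
      rw [Real.coe_toNNReal _ (by positivity)]
      refine hH.sum_sq_le (fun i => ?_) c hc
      split_ifs with hi
      · exact hw i hi
      · simpa using hβ.le
    · intro q
      simp only [hB, mul_pow, hH.sq_eq_one, one_mul, hv]
      simp
  have hXm : Measurable X := by
    have h1 := (hφ.gauss v).continuous
    have h2 := hφ.continuous
    fun_prop
  have hkey : ∀ D : Fin m → ι → ℝ, ∑ p, X (D p) = -(m * d) * (transformAvg H φ w D -
        transformAvg H (gaussSmooth φ v) (fun i => if i ∈ S then 0 else w i) D) := by
    intro D
    have e1 : ∀ p q, ∑ i, A q i * D p i =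
        ∑ i, H q i * (D p i * (if i ∈ S then 0 else w i)) := fun p q =>
      Finset.sum_congr rfl fun i _ => by simp only [hA]; ring
    have e2 : ∀ p q, ∑ i, A q i * D p i + ∑ i, B q i * D p i =
        ∑ i, H q i * (D p i * w i) := fun p q => by
      rw [← Finset.sum_add_distrib]
      refine Finset.sum_congr rfl fun i _ => ?_
      simp only [hA, hB]
      split_ifs <;> ring
    simp only [hX, transformAvg, e2]
    simp only [e1, Finset.sum_sub_distrib]
    rw [← hd]
    field_simp
    ring
  have hindep : iIndepFun (fun (p : Fin m) (D : Fin m → ι → ℝ) => X (D p))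
      (Measure.pi fun _ : Fin m => stdPi ι) :=
    iIndepFun_pi (X := fun _ => X) fun _ => hXm.aemeasurable
  have hsubp : ∀ p : Fin m, HasSubgaussianMGF (fun D : Fin m → ι → ℝ => X (D p))
      (NNReal.pi ^ 2 / 4 * (β ^ 2 * d ^ 2).toNNReal) (Measure.pi fun _ : Fin m => stdPi ι) := by
    intro p
    refine HasSubgaussianMGF.of_map (Y := fun D : Fin m → ι → ℝ => D p) (X := X)
      (measurable_pi_apply p).aemeasurable ?_
    rw [(measurePreserving_eval (fun _ : Fin m => stdPi ι) p).map_eq]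
    exact hsub
  have hsum : HasSubgaussianMGF (fun D : Fin m → ι → ℝ => ∑ p, X (D p))
      (∑ _p : Fin m, NNReal.pi ^ 2 / 4 * (β ^ 2 * d ^ 2).toNNReal)
      (Measure.pi fun _ : Fin m => stdPi ι) :=
    HasSubgaussianMGF.sum_of_iIndepFun hindep (s := Finset.univ) fun p _ => hsubp p
  have hmdτ : 0 ≤ m * d * τ := by positivity
  have hexp : exp (-(m * d * τ) ^ 2 /
      (2 * (∑ _p : Fin m, NNReal.pi ^ 2 / 4 * (β ^ 2 * d ^ 2).toNNReal : ℝ≥0)))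
      ≤ exp (-(τ ^ 2 * m / (5 * β ^ 2))) := by
    refine exp_le_exp.mpr ?_
    simp only [Finset.sum_const, Finset.card_univ, Fintype.card_fin, nsmul_eq_mul]
    push_cast
    rw [NNReal.coe_real_pi, Real.coe_toNNReal _ (by positivity), neg_div, neg_le_neg_iff]
    have hpi : π ^ 2 ≤ 10 := by nlinarith [pi_lt_d2, pi_pos]
    have : (m * d * τ) ^ 2 / (2 * (m * (π ^ 2 / 4 * (β ^ 2 * d ^ 2))))
        = 2 * τ ^ 2 * m / (π ^ 2 * β ^ 2) := by field_simp; ring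
    rw [this, div_le_div_iff₀ (by positivity) (by positivity)]
    have : 0 ≤ τ ^ 2 * m * β ^ 2 := by positivity
    nlinarith
  have h1 := hsum.measure_ge_le hmdτ
  have h2 := hsum.neg.measure_ge_le hmdτ
  set μ := (Measure.pi fun _ : Fin m => stdPi ι)
  have hsubset : {D | τ ≤ |transformAvg H φ w D -
        transformAvg H (gaussSmooth φ v) (fun i => if i ∈ S then 0 else w i) D|} ⊆
      {D | m * d * τ ≤ ∑ p, X (D p)} ∪
        {D | m * d * τ ≤ (-fun D : Fin m → ι → ℝ => ∑ p, X (D p)) D} := by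
    intro D hD
    simp only [Set.mem_union, Set.mem_ofPred_eq, Pi.neg_apply, hkey] at hD ⊢
    have hmd : 0 < m * d := by positivity
    rcases le_abs.mp hD with h | h
    · right; nlinarith
    · left; nlinarith
  calc μ _ ≤ μ {D | m * d * τ ≤ ∑ p, X (D p)} +
        μ {D | m * d * τ ≤ (-fun D : Fin m → ι → ℝ => ∑ p, X (D p)) D} :=
        (measure_mono hsubset).trans (measure_union_le _ _)
    _ ≤ ENNReal.ofReal (exp (-(τ ^ 2 * m / (5 * β ^ 2)))) +
        ENNReal.ofReal (exp (-(τ ^ 2 * m / (5 * β ^ 2)))) := by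
        refine add_le_add ?_ ?_ <;> rw [← ofReal_measureReal] <;>
          refine ENNReal.ofReal_le_ofReal (le_trans ?_ hexp)
        · exact h1
        · exact h2
    _ = _ := by rw [← ENNReal.ofReal_add (exp_pos _).le (exp_pos _).le, two_mul]

end

section

variable {ι : Type*}

/-- The vector of the dyadic grid `2⁻ᴷ ℤ` with numerators `n`. -/
def gridVec (K : ℕ) (n : ι → ℤ) (i : ι) : ℝ := n i / 2 ^ K

/-- Discards the coordinates of `gridVec K n` of absolute value at most `2⁻ʲ`. -/
def gridCut (K j : ℕ) (n : ι → ℤ) (i : ι) : ℤ := if (n i).natAbs * 2 ^ j ≤ 2 ^ K then 0 else n i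

theorem mul_two_pow_le_of_succ {a b j : ℕ} (h : a * 2 ^ (j + 1) ≤ b) : a * 2 ^ j ≤ b :=
  (Nat.mul_le_mul_left a (Nat.pow_le_pow_right two_pos j.le_succ)).trans h

theorem gridCut_gridCut_succ (K j : ℕ) (n : ι → ℤ) :
    gridCut K j (gridCut K (j + 1) n) = gridCut K j n := by
  ext i
  simp only [gridCut]
  by_cases h : (n i).natAbs * 2 ^ (j + 1) ≤ 2 ^ K
  · simp [h, mul_two_pow_le_of_succ h]
  · simp [h]

variable [Fintype ι]

/-- The squared mass, in units of `4⁻ᴷ`, discarded by `gridCut`. -/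
def gridTail (K j : ℕ) (n : ι → ℤ) : ℕ :=
  ∑ i, if (n i).natAbs * 2 ^ j ≤ 2 ^ K then (n i).natAbs ^ 2 else 0

theorem gridTail_succ_add (K j : ℕ) (n : ι → ℤ) :
    gridTail K j (gridCut K (j + 1) n) + gridTail K (j + 1) n = gridTail K j n := by
  simp only [gridTail, ← Finset.sum_add_distrib]
  refine Finset.sum_congr rfl fun i _ => ?_
  simp only [gridCut]
  by_cases h : (n i).natAbs * 2 ^ (j + 1) ≤ 2 ^ K
  · simp [h, mul_two_pow_le_of_succ h]
  · simp [h]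

theorem card_support_le_of_lt {K j : ℕ} {n : ι → ℤ}
    (h1 : ∀ i, n i ≠ 0 → 2 ^ K < (n i).natAbs * 2 ^ (j + 1))
    (h2 : ∑ i, (n i).natAbs ^ 2 ≤ (2 ^ K) ^ 2) :
    (Finset.univ.filter fun i => n i ≠ 0).card ≤ 4 ^ (j + 1) := by
  have hpos : 0 < (2 ^ K) ^ 2 := by positivity
  refine Nat.le_of_mul_le_mul_right (c := (2 ^ K) ^ 2) ?_ hpos
  calc (Finset.univ.filter fun i => n i ≠ 0).card * (2 ^ K) ^ 2
      = ∑ i ∈ Finset.univ.filter fun i => n i ≠ 0, (2 ^ K) ^ 2 := by simp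
    _ ≤ ∑ i ∈ Finset.univ.filter fun i => n i ≠ 0, (n i).natAbs ^ 2 * 4 ^ (j + 1) := by
        refine Finset.sum_le_sum fun i hi => ?_
        have := h1 i (Finset.mem_filter.mp hi).2
        calc (2 ^ K) ^ 2 ≤ ((n i).natAbs * 2 ^ (j + 1)) ^ 2 := Nat.pow_le_pow_left this.le 2
          _ = (n i).natAbs ^ 2 * 4 ^ (j + 1) := by
            rw [mul_pow, ← pow_mul, mul_comm (j + 1) 2, pow_mul]; norm_num
    _ ≤ ∑ i, (n i).natAbs ^ 2 * 4 ^ (j + 1) :=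
        Finset.sum_le_sum_of_subset (Finset.filter_subset _ _)
    _ ≤ 4 ^ (j + 1) * (2 ^ K) ^ 2 := by
        rw [← Finset.sum_mul, mul_comm]
        exact Nat.mul_le_mul_left _ h2

theorem sum_exp_neg_card_support_le (M : ℕ) (a : ℝ) :
    ∑ n ∈ Fintype.piFinset (fun _ : ι => Finset.Icc (-M : ℤ) M),
        exp (-(a * (Finset.univ.filter fun i => n i ≠ 0).card)) ≤
      exp (2 * M * Fintype.card ι * exp (-a)) := by
  have h1 : ∀ n : ι → ℤ, exp (-(a * (Finset.univ.filter fun i => n i ≠ 0).card))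
      = ∏ i, if n i = 0 then 1 else exp (-a) := by
    intro n
    rw [Finset.prod_ite]
    simp only [Finset.prod_const, one_pow, one_mul]
    rw [← exp_nat_mul]
    congr 1
    ring
  simp_rw [h1]
  rw [← Finset.prod_univ_sum (fun _ : ι => Finset.Icc (-M : ℤ) M)
    (fun _ a' => if a' = 0 then (1 : ℝ) else exp (-a))]
  have h2 : ∑ a' ∈ Finset.Icc (-M : ℤ) M, (if a' = 0 then (1 : ℝ) else exp (-a))
      ≤ exp (2 * M * exp (-a)) := by
    have h0 : (0 : ℤ) ∈ Finset.Icc (-M : ℤ) M := by simp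
    rw [← Finset.add_sum_erase _ _ h0]
    have h3 : ∑ a' ∈ (Finset.Icc (-M : ℤ) M).erase 0, (if a' = 0 then (1 : ℝ) else exp (-a))
        = 2 * M * exp (-a) := by
      rw [Finset.sum_congr rfl fun a' ha' => if_neg (Finset.ne_of_mem_erase ha'),
        Finset.sum_const, Finset.card_erase_of_mem h0, Int.card_Icc, nsmul_eq_mul]
      congr 1
      have : ((M : ℤ) + 1 - -M).toNat - 1 = 2 * M := by omega
      rw [this]; push_cast; ring
    rw [h3]
    simpa [add_comm] using add_one_le_exp (2 * M * exp (-a))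
  rw [Finset.prod_const, Finset.card_univ]
  refine (pow_le_pow_left₀ (Finset.sum_nonneg fun _ _ => ?_) h2 _).trans_eq ?_
  · split_ifs <;> positivity
  · rw [← exp_nat_mul]; congr 1; ring

variable {H : Matrix ι ι ℝ}

/-- The event that replacing the coordinates of `gridVec K n` of size at most `2⁻ʲ` by an
independent Gaussian fluctuation changes the empirical average by at least `τ`. -/
def gridBad (H : Matrix ι ι ℝ) (m : ℕ) (φ : ℝ → ℝ) (τ : ℝ) (K j k : ℕ) (n : ι → ℤ) :
    Set (Fin m → ι → ℝ) :=
  {D | τ ≤ |transformAvg H (gaussSmooth φ (k / (2 ^ K) ^ 2)) (gridVec K n) D -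
    transformAvg H (gaussSmooth φ ((gridTail K j n + k : ℕ) / (2 ^ K) ^ 2))
      (gridVec K (gridCut K j n)) D|}

theorem measure_gridBad_le [Nonempty ι] (hH : IsHadamardMatrix H) {φ : ℝ → ℝ}
    (hφ : SmoothBounded φ) {m : ℕ} (hm : 0 < m) {τ : ℝ} (hτ : 0 ≤ τ) (K j k : ℕ) (n : ι → ℤ) :
    (Measure.pi fun _ : Fin m => stdPi ι) (gridBad H m φ τ K j k n) ≤
      ENNReal.ofReal (2 * exp (-(τ ^ 2 * m / 5 * 4 ^ j))) := by
  set S : Finset ι := Finset.univ.filter fun i => (n i).natAbs * 2 ^ j ≤ 2 ^ K with hS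
  have h := measure_transformAvg_sub_gaussSmooth_ge_le hH
    (hφ.gauss ((k : ℝ≥0) / (2 ^ K) ^ 2)) hm (w := gridVec K n) (S := S)
    (β := (2 ^ j)⁻¹) (by positivity) ?_ (v := (gridTail K j n : ℝ≥0) / (2 ^ K) ^ 2) ?_ hτ
  · have h1 : (fun i => if i ∈ S then 0 else gridVec K n i) = gridVec K (gridCut K j n) := by
      ext i
      simp only [hS, Finset.mem_filter, Finset.mem_univ, true_and, gridVec, gridCut]
      split_ifs <;> simp
    rw [hφ.gaussSmooth_gaussSmooth, h1, ← add_div, ← Nat.cast_add] at h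
    refine h.trans_eq ?_
    congr 4
    have : (4 : ℝ) ^ j = (2 ^ j) ^ 2 := by rw [← pow_mul, mul_comm, pow_mul]; norm_num
    rw [this]
    field_simp
  · intro i hi
    have hi' : (n i).natAbs * 2 ^ j ≤ 2 ^ K := by simpa [hS] using hi
    have hi'' : |(n i : ℝ)| * 2 ^ j ≤ 2 ^ K := by
      rw [← Int.cast_abs, ← Nat.cast_natAbs]; exact_mod_cast hi'
    rw [gridVec, abs_div, abs_of_pos (by positivity : (0 : ℝ) < 2 ^ K),
      div_le_iff₀ (by positivity), ← div_eq_inv_mul, le_div_iff₀ (by positivity)]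
    exact hi''
  · push_cast [gridTail]
    rw [Finset.sum_div, hS, Finset.sum_filter]
    refine Finset.sum_congr rfl fun i _ => ?_
    split_ifs
    · rw [gridVec, div_pow, NNReal.coe_pow, NNReal.coe_natCast, Nat.cast_natAbs, Int.cast_abs,
        sq_abs]
    · simp

/-- Numerators of grid vectors of norm at most one whose nonzero coordinates exceed `2⁻⁽ʲ⁺¹⁾`. -/
def gridLevel (ι : Type*) [Fintype ι] (K j : ℕ) : Finset (ι → ℤ) :=
  (Fintype.piFinset fun _ : ι => Finset.Icc (-(2 ^ K : ℕ) : ℤ) (2 ^ K : ℕ)).filter fun n =>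
    (∀ i, n i ≠ 0 → 2 ^ K < (n i).natAbs * 2 ^ (j + 1)) ∧
      ∑ i, (n i).natAbs ^ 2 ≤ (2 ^ K) ^ 2

theorem measure_iUnion_gridBad_le [Nonempty ι] (hH : IsHadamardMatrix H) {φ : ℝ → ℝ}
    (hφ : SmoothBounded φ) {m : ℕ} (hm : 0 < m) {τ : ℝ} (hτ : 0 ≤ τ) (K : ℕ) :
    (Measure.pi fun _ : Fin m => stdPi ι) (⋃ j ∈ Finset.range (K + 1),
        ⋃ n ∈ gridLevel ι K j, ⋃ k ∈ Finset.range ((2 ^ K) ^ 2 + 1), gridBad H m φ τ K j k n) ≤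
      ENNReal.ofReal ((K + 1) * (((2 ^ K) ^ 2 + 1) * (2 * exp (-(4 * (τ ^ 2 * m / 40))) *
        exp (2 * 2 ^ K * Fintype.card ι * exp (-(τ ^ 2 * m / 40)))))) := by
  set a : ℝ := τ ^ 2 * m / 40 with ha
  have ha0 : 0 ≤ a := by positivity
  set μ := Measure.pi fun _ : Fin m => stdPi ι
  have hsingle : ∀ j, ∀ n ∈ gridLevel ι K j, ∀ k, μ (gridBad H m φ τ K j k n) ≤
      ENNReal.ofReal (2 * exp (-(4 * a)) *
        exp (-(a * (Finset.univ.filter fun i => n i ≠ 0).card))) := by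
    intro j n hn k
    refine (measure_gridBad_le hH hφ hm hτ K j k n).trans (ENNReal.ofReal_le_ofReal ?_)
    rw [mul_assoc, ← exp_add]
    refine mul_le_mul_of_nonneg_left (exp_le_exp.mpr ?_) two_pos.le
    have hn' := (Finset.mem_filter.mp hn).2
    have hc : ((Finset.univ.filter fun i => n i ≠ 0).card : ℝ) ≤ 4 ^ (j + 1) := by
      exact_mod_cast card_support_le_of_lt hn'.1 hn'.2
    have h1 : (1 : ℝ) ≤ 4 ^ j := one_le_pow₀ (by norm_num)
    have h2 : τ ^ 2 * m / 5 * 4 ^ j = a * (8 * 4 ^ j) := by rw [ha]; ring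
    rw [h2, pow_succ] at *
    nlinarith [mul_le_mul_of_nonneg_left hc ha0, mul_le_mul_of_nonneg_left h1 ha0]
  have hlevel : ∀ j, ∑ n ∈ gridLevel ι K j, exp (-(a * (Finset.univ.filter fun i => n i ≠ 0).card))
      ≤ exp (2 * 2 ^ K * Fintype.card ι * exp (-a)) := by
    intro j
    refine (Finset.sum_le_sum_of_subset_of_nonneg (Finset.filter_subset _ _)
      fun _ _ _ => (exp_pos _).le).trans ?_
    have := sum_exp_neg_card_support_le (ι := ι) (2 ^ K) a
    push_cast at this ⊢
    exact this
  calc _ ≤ ∑ j ∈ Finset.range (K + 1), ∑ n ∈ gridLevel ι K j,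
        ∑ k ∈ Finset.range ((2 ^ K) ^ 2 + 1), ENNReal.ofReal (2 * exp (-(4 * a)) *
          exp (-(a * (Finset.univ.filter fun i => n i ≠ 0).card))) := by
        refine (measure_biUnion_finset_le _ _).trans (Finset.sum_le_sum fun j _ => ?_)
        refine (measure_biUnion_finset_le _ _).trans (Finset.sum_le_sum fun n hn => ?_)
        exact (measure_biUnion_finset_le _ _).trans (Finset.sum_le_sum fun k _ => hsingle j n hn k)
    _ = ENNReal.ofReal (∑ j ∈ Finset.range (K + 1), ∑ n ∈ gridLevel ι K j,
        ∑ k ∈ Finset.range ((2 ^ K) ^ 2 + 1), 2 * exp (-(4 * a)) *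
          exp (-(a * (Finset.univ.filter fun i => n i ≠ 0).card))) := by
        rw [ENNReal.ofReal_sum_of_nonneg fun _ _ => by positivity]
        refine Finset.sum_congr rfl fun j _ => ?_
        rw [ENNReal.ofReal_sum_of_nonneg fun _ _ => by positivity]
        refine Finset.sum_congr rfl fun n _ => ?_
        rw [ENNReal.ofReal_sum_of_nonneg fun _ _ => by positivity]
    _ ≤ _ := by
        refine ENNReal.ofReal_le_ofReal ?_
        calc _ ≤ ∑ j ∈ Finset.range (K + 1), (((2 ^ K) ^ 2 + 1) * (2 * exp (-(4 * a)) *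
            exp (2 * 2 ^ K * Fintype.card ι * exp (-a))) : ℝ) := by
              refine Finset.sum_le_sum fun j _ => ?_
              simp only [Finset.sum_const, Finset.card_range, nsmul_eq_mul, ← Finset.mul_sum]
              push_cast
              gcongr
              exact hlevel j
          _ = _ := by simp

theorem abs_transformAvg_gridVec_sub_le [Nonempty ι] {φ : ℝ → ℝ} {m : ℕ} (hm : 0 < m) {τ : ℝ}
    {K : ℕ} {D : Fin m → ι → ℝ} (hD : D ∉ ⋃ j ∈ Finset.range (K + 1),
        ⋃ n ∈ gridLevel ι K j, ⋃ k ∈ Finset.range ((2 ^ K) ^ 2 + 1), gridBad H m φ τ K j k n)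
    {n : ι → ℤ} (hn : ∑ i, (n i).natAbs ^ 2 ≤ (2 ^ K) ^ 2) :
    |transformAvg H φ (gridVec K n) D -
      gaussSmooth φ ((∑ i, (n i).natAbs ^ 2 : ℕ) / (2 ^ K) ^ 2) 0| ≤ (K + 1) * τ := by
  have hD' : ∀ j < K + 1, ∀ n ∈ gridLevel ι K j, ∀ k < (2 ^ K) ^ 2 + 1,
      D ∉ gridBad H m φ τ K j k n := by
    intro j hj n hn k hk hmem
    refine hD ?_
    simp only [Set.mem_iUnion, Finset.mem_range]
    exact ⟨j, hj, n, hn, k, hk, hmem⟩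
  have hni : ∀ i, (n i).natAbs ≤ 2 ^ K := fun i => by
    refine (Nat.pow_le_pow_iff_left (two_ne_zero)).mp (le_trans ?_ hn)
    exact Finset.single_le_sum (f := fun i => (n i).natAbs ^ 2) (fun _ _ => Nat.zero_le _)
      (Finset.mem_univ i)
  set G : ℕ → ℝ := fun j => transformAvg H (gaussSmooth φ (gridTail K j n / (2 ^ K) ^ 2))
    (gridVec K (gridCut K j n)) D with hG
  have hstep : ∀ j < K + 1, |G (j + 1) - G j| ≤ τ := by
    intro j hj
    have hcut : ∀ i, (gridCut K (j + 1) n i).natAbs ≤ (n i).natAbs := fun i => by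
      simp only [gridCut]; split_ifs <;> simp
    have hmem : gridCut K (j + 1) n ∈ gridLevel ι K j := by
      refine Finset.mem_filter.mpr ⟨?_, ?_, ?_⟩
      · refine Fintype.mem_piFinset.mpr fun i => ?_
        have := (hcut i).trans (hni i)
        rw [Finset.mem_Icc]
        omega
      · intro i hi
        simp only [gridCut] at hi ⊢
        split_ifs at hi ⊢ with h
        · exact absurd rfl hi
        · exact not_le.mp h
      · exact (Finset.sum_le_sum fun i _ => Nat.pow_le_pow_left (hcut i) 2).trans hn
    have htail : gridTail K (j + 1) n < (2 ^ K) ^ 2 + 1 := by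
      refine Nat.lt_succ_of_le (le_trans (Finset.sum_le_sum fun i _ => ?_) hn)
      split_ifs <;> simp
    have h := hD' j hj _ hmem _ htail
    simp only [gridBad, Set.mem_ofPred_eq, not_le, gridTail_succ_add, gridCut_gridCut_succ] at h
    exact h.le
  have htel : ∀ J ≤ K + 1, |G J - G 0| ≤ J * τ := by
    intro J
    induction J with
    | zero => simp
    | succ J ih =>
      intro hJ
      have h1 := ih (by omega)
      have h2 := hstep J (by omega)
      have h3 := abs_add_le (G (J + 1) - G J) (G J - G 0)
      rw [sub_add_sub_cancel] at h3
      push_cast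
      linarith
  have hG0 : G 0 = gaussSmooth φ ((∑ i, (n i).natAbs ^ 2 : ℕ) / (2 ^ K) ^ 2) 0 := by
    have hd : (0 : ℝ) < Fintype.card ι := by exact_mod_cast Fintype.card_pos
    have hm0 : (0 : ℝ) < m := by exact_mod_cast hm
    simp only [hG, gridTail, gridCut, pow_zero, mul_one, hni, if_true, transformAvg, gridVec]
    simp
    field_simp
  have hGK : G (K + 1) = transformAvg H φ (gridVec K n) D := by
    have hz : ∀ i, (n i).natAbs * 2 ^ (K + 1) ≤ 2 ^ K ↔ n i = 0 := by
      intro i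
      constructor
      · intro h
        by_contra h0
        have h1 : 1 ≤ (n i).natAbs := Int.natAbs_pos.mpr h0
        have h2 : 0 < 2 ^ K := by positivity
        rw [pow_succ] at h
        nlinarith
      · intro h; simp [h]
    have h1 : gridCut K (K + 1) n = n := by
      ext i
      simp only [gridCut, hz]
      split_ifs with h
      · exact h.symm
      · rfl
    have h2 : gridTail K (K + 1) n = 0 := by
      simp only [gridTail, hz]
      refine Finset.sum_eq_zero fun i _ => ?_
      split_ifs with h <;> simp [h]
    simp only [hG, h1, h2, Nat.cast_zero, zero_div, gaussSmooth_zero]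
  have h := htel (K + 1) le_rfl
  rw [hG0, hGK] at h
  exact_mod_cast h

end

/-- The truncated absolute value `min |x| r`, averaged over a window of width `κ`. -/
def smoothTrunc (κ r x : ℝ) : ℝ := κ⁻¹ * ∫ t in x..x + κ, min |t| r

theorem continuous_min_abs (r : ℝ) : Continuous fun t : ℝ => min |t| r :=
  continuous_abs.min continuous_const

theorem abs_min_abs_sub_min_abs_le (r x y : ℝ) : |min |x| r - min |y| r| ≤ |x - y| := by
  have h1 := abs_abs_sub_abs_le_abs_sub x y
  have h2 := abs_min_sub_min_le_max |x| r |y| r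
  simp only [sub_self, abs_zero] at h2
  exact h2.trans (max_le h1 (abs_nonneg _))

theorem hasDerivAt_smoothTrunc (κ r x : ℝ) :
    HasDerivAt (smoothTrunc κ r) (κ⁻¹ * (min |x + κ| r - min |x| r)) x := by
  have hc := continuous_min_abs r
  have h1 : ∀ y, HasDerivAt (fun u => ∫ t in (0 : ℝ)..u, min |t| r) (min |y| r) y := fun y =>
    intervalIntegral.integral_hasDerivAt_right (hc.intervalIntegrable _ _)
      (hc.stronglyMeasurableAtFilter _ _) hc.continuousAt
  have h2 := (h1 (x + κ)).comp_add_const x κ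
  have h3 : smoothTrunc κ r = fun y => κ⁻¹ *
      ((∫ t in (0 : ℝ)..y + κ, min |t| r) - ∫ t in (0 : ℝ)..y, min |t| r) := by
    ext y
    rw [intervalIntegral.integral_interval_sub_left (hc.intervalIntegrable _ _)
      (hc.intervalIntegrable _ _), smoothTrunc]
  rw [h3]
  exact (h2.sub (h1 x)).const_mul κ⁻¹

theorem smoothBounded_smoothTrunc {κ r : ℝ} (hκ : 0 < κ) (hr : 0 ≤ r) :
    SmoothBounded (smoothTrunc κ r) := by
  have hd : deriv (smoothTrunc κ r) = fun x => κ⁻¹ * (min |x + κ| r - min |x| r) :=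
    funext fun x => (hasDerivAt_smoothTrunc κ r x).deriv
  refine ⟨fun x => (hasDerivAt_smoothTrunc κ r x).differentiableAt, ?_, fun x => ?_, r, fun x => ?_⟩
  · rw [hd]
    have hc := continuous_min_abs r
    fun_prop
  · rw [hd]
    have := abs_min_abs_sub_min_abs_le r (x + κ) x
    rw [add_sub_cancel_left, abs_of_pos hκ] at this
    rw [abs_mul, abs_of_pos (inv_pos.mpr hκ), inv_mul_le_iff₀ hκ]
    simpa using this
  · have := intervalIntegral.norm_integral_le_of_norm_le_const (a := x) (b := x + κ) (C := r)
      (f := fun t => min |t| r) fun t _ => by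
        rw [norm_eq_abs, abs_of_nonneg (le_min (abs_nonneg _) hr)]
        exact min_le_right _ _
    rw [add_sub_cancel_left, abs_of_pos hκ, norm_eq_abs] at this
    rwa [smoothTrunc, abs_mul, abs_of_pos (inv_pos.mpr hκ), inv_mul_le_iff₀ hκ, mul_comm κ]

theorem abs_smoothTrunc_sub_le {κ : ℝ} (hκ : 0 < κ) (r x : ℝ) :
    |smoothTrunc κ r x - min |x| r| ≤ κ := by
  have hc := continuous_min_abs r
  have h1 : smoothTrunc κ r x - min |x| r = κ⁻¹ * ∫ t in x..x + κ, (min |t| r - min |x| r) := by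
    rw [intervalIntegral.integral_sub (hc.intervalIntegrable _ _) (by simp), smoothTrunc]
    simp
    field_simp
  have := intervalIntegral.norm_integral_le_of_norm_le_const (a := x) (b := x + κ) (C := κ)
      (f := fun t => min |t| r - min |x| r) fun t ht => by
        rw [Set.uIoc_of_le (by linarith)] at ht
        refine (abs_min_abs_sub_min_abs_le r t x).trans ?_
        rw [abs_of_nonneg (by linarith [ht.1])]
        linarith [ht.2]
  rw [add_sub_cancel_left, abs_of_pos hκ, norm_eq_abs] at this
  rwa [h1, abs_mul, abs_of_pos (inv_pos.mpr hκ), inv_mul_le_iff₀ hκ]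

theorem integrable_abs_gaussianReal (v : ℝ≥0) : Integrable (fun x => |x|) (gaussianReal 0 v) :=
  ((memLp_id_gaussianReal 1).integrable (by simp)).abs

theorem integral_abs_gaussianReal : ∫ x, |x| ∂gaussianReal 0 1 = √(2 / π) := by
  rw [integral_gaussianReal_eq_integral_smul one_ne_zero]
  have h1 : ∀ x : ℝ, gaussianPDFReal 0 1 x • |x| =
      (√(2 * π))⁻¹ * ((fun y : ℝ => y ^ (1 : ℝ) * exp (-(1 / 2) * y ^ (2 : ℝ))) |x|) := by
    intro x
    simp only [gaussianPDFReal, rpow_two, sq_abs, rpow_one, smul_eq_mul, NNReal.coe_one, sub_zero,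
      mul_one]
    rw [show -(1 / 2) * x ^ 2 = -x ^ 2 / 2 by ring]
    ring
  simp_rw [h1]
  rw [integral_const_mul,
    integral_comp_abs (f := fun y : ℝ => y ^ (1 : ℝ) * exp (-(1 / 2) * y ^ (2 : ℝ))),
    integral_rpow_mul_exp_neg_mul_rpow two_pos (by norm_num) (by norm_num)]
  norm_num
  have h2 := sq_sqrt (zero_le_two (α := ℝ))
  have : √2 ≠ 0 := by positivity
  field_simp
  linarith

theorem integrable_exp_mul_abs_gaussianReal (t : ℝ) :
    Integrable (fun x => exp (t * |x|)) (gaussianReal 0 1) := by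
  refine ((integrable_exp_mul_gaussianReal t).add (integrable_exp_mul_gaussianReal (-t))).mono'
    (by fun_prop) (Filter.Eventually.of_forall fun x => ?_)
  rw [norm_eq_abs, abs_exp]
  rcases abs_cases x with ⟨h, _⟩ | ⟨h, _⟩ <;> rw [h] <;> simp [exp_nonneg]

theorem integral_exp_mul_abs_gaussianReal_le (t : ℝ) :
    ∫ x, exp (t * |x|) ∂gaussianReal 0 1 ≤ 2 * exp (t ^ 2 / 2) := by
  have hm : ∀ s : ℝ, ∫ x, exp (s * x) ∂gaussianReal 0 1 = exp (s ^ 2 / 2) := fun s => by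
    have := congrFun (mgf_fun_id_gaussianReal (μ := 0) (v := 1)) s
    simpa [mgf] using this
  calc ∫ x, exp (t * |x|) ∂gaussianReal 0 1
      ≤ ∫ x, (exp (t * x) + exp (-t * x)) ∂gaussianReal 0 1 := by
        refine integral_mono (integrable_exp_mul_abs_gaussianReal t)
          ((integrable_exp_mul_gaussianReal t).add (integrable_exp_mul_gaussianReal (-t)))
          fun x => ?_
        rcases abs_cases x with ⟨h, _⟩ | ⟨h, _⟩ <;> simp only [h] <;> simp [exp_nonneg]
    _ = _ := by
        rw [integral_add (integrable_exp_mul_gaussianReal t) (integrable_exp_mul_gaussianReal (-t)),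
          hm, hm, neg_sq, two_mul]

theorem integrable_min_abs_gaussianReal {r : ℝ} (hr : 0 ≤ r) :
    Integrable (fun x => min |x| r) (gaussianReal 0 1) :=
  (integrable_abs_gaussianReal 1).mono' (by fun_prop) (Filter.Eventually.of_forall fun x => by
    rw [norm_eq_abs, abs_of_nonneg (le_min (abs_nonneg _) hr)]
    exact min_le_left _ _)

theorem integral_min_abs_gaussianReal_le {r : ℝ} (hr : 0 ≤ r) :
    ∫ x, min |x| r ∂gaussianReal 0 1 ≤ √(2 / π) :=
  integral_abs_gaussianReal ▸ integral_mono (integrable_min_abs_gaussianReal hr)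
    (integrable_abs_gaussianReal 1) fun _ => min_le_left _ _

theorem sub_le_integral_min_abs_gaussianReal {r : ℝ} (hr : 0 < r) :
    √(2 / π) - 2 * exp (-(r ^ 2 / 2)) / r ≤ ∫ x, min |x| r ∂gaussianReal 0 1 := by
  have hpt : ∀ x : ℝ, |x| - exp (-r ^ 2) / r * exp (r * |x|) ≤ min |x| r := by
    intro x
    have he : exp (-r ^ 2) / r * exp (r * |x|) = exp (r * (|x| - r)) / r := by
      rw [div_mul_eq_mul_div, ← exp_add]
      ring_nf
    rw [he]
    have h0 : 0 ≤ exp (r * (|x| - r)) / r := by positivity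
    refine le_min (by linarith) ?_
    have h1 : |x| - r ≤ exp (r * (|x| - r)) / r := by
      rw [le_div_iff₀ hr]
      linarith [add_one_le_exp (r * (|x| - r))]
    linarith
  have hi := (integrable_exp_mul_abs_gaussianReal r).const_mul (exp (-r ^ 2) / r)
  have h := integral_mono ((integrable_abs_gaussianReal 1).sub hi)
    (integrable_min_abs_gaussianReal hr.le) hpt
  simp only [Pi.sub_apply] at h
  rw [integral_sub (integrable_abs_gaussianReal 1) hi, integral_abs_gaussianReal,
    integral_const_mul] at h
  have h2 : exp (-r ^ 2) / r * ∫ x, exp (r * |x|) ∂gaussianReal 0 1 ≤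
      2 * exp (-(r ^ 2 / 2)) / r := by
    calc _ ≤ exp (-r ^ 2) / r * (2 * exp (r ^ 2 / 2)) :=
          mul_le_mul_of_nonneg_left (integral_exp_mul_abs_gaussianReal_le r) (by positivity)
      _ = 2 * (exp (-r ^ 2) * exp (r ^ 2 / 2)) / r := by ring
      _ = _ := by rw [← exp_add]; ring_nf
  linarith

theorem abs_gaussSmooth_sub_gaussSmooth_one_le {φ : ℝ → ℝ} (hφ : SmoothBounded φ) (v : ℝ≥0) :
    |gaussSmooth φ v 0 - gaussSmooth φ 1 0| ≤ |√v - 1| := by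
  have hmap : gaussianReal 0 v = (gaussianReal 0 1).map (√v * ·) := by
    rw [gaussianReal_map_const_mul]
    congr 1
    · simp
    · ext; simp
  have h1 : gaussSmooth φ v 0 = ∫ x, φ (√v * x) ∂gaussianReal 0 1 := by
    rw [gaussSmooth, hmap, integral_map (by fun_prop)]
    · simp
    · exact (hφ.continuous.comp (by fun_prop)).aestronglyMeasurable
  have h2 : gaussSmooth φ 1 0 = ∫ x, φ x ∂gaussianReal 0 1 := by simp [gaussSmooth]
  have hlt : √(2 / π) ≤ 1 := by
    rw [sqrt_le_one, div_le_one pi_pos]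
    exact two_le_pi
  have hi1 : Integrable (fun x => φ (√v * x)) (gaussianReal 0 1) :=
    hφ.integrable_comp (by fun_prop)
  have hi2 : Integrable φ (gaussianReal 0 1) := hφ.integrable_comp measurable_id
  rw [h1, h2, ← integral_sub hi1 hi2]
  calc _ ≤ ∫ x, |φ (√v * x) - φ x| ∂gaussianReal 0 1 := abs_integral_le_integral_abs
    _ ≤ ∫ x, |√v - 1| * |x| ∂gaussianReal 0 1 := by
        refine integral_mono (hi1.sub hi2).abs ((integrable_abs_gaussianReal 1).const_mul _)
          fun x => ?_
        refine (hφ.abs_sub_le _ _).trans_eq ?_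
        rw [← abs_mul]
        ring_nf
    _ ≤ _ := by
        rw [integral_const_mul, integral_abs_gaussianReal]
        exact mul_le_of_le_one_right (abs_nonneg _) hlt

theorem integral_prod_stdPi (ι : Type*) [Fintype ι] (f : ℝ → ℝ) :
    ∫ x, ∏ i, f (x i) ∂stdPi ι = (∫ x, f x ∂gaussianReal 0 1) ^ Fintype.card ι :=
  integral_fintype_prod_eq_pow f

theorem integrable_prod_stdPi (ι : Type*) [Fintype ι] {f : ℝ → ℝ}
    (hf : Integrable f (gaussianReal 0 1)) : Integrable (fun x => ∏ i, f (x i)) (stdPi ι) :=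
  Integrable.fintype_prod fun _ => hf

/-- A Chernoff bound for the `ℓ¹` norm of an array of standard Gaussians. -/
theorem measure_sum_abs_ge_le_s14 (ι : Type*) [Fintype ι] (m : ℕ) :
    (Measure.pi fun _ : Fin m => stdPi ι)
        {D | 3 * (m * Fintype.card ι) ≤ ∑ p, ∑ i, |D p i|} ≤
      ENNReal.ofReal (exp (-(m * Fintype.card ι))) := by
  set f : ℝ → ℝ := fun x => exp (1 * |x|) with hf
  set g : (ι → ℝ) → ℝ := fun x => ∏ i, f (x i) with hg
  have hgi : Integrable g (stdPi ι) :=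
    integrable_prod_stdPi ι (integrable_exp_mul_abs_gaussianReal 1)
  have h1 : (fun D : Fin m → ι → ℝ => exp (1 * ∑ p, ∑ i, |D p i|)) = fun D => ∏ p, g (D p) := by
    ext D
    simp [hf, hg, exp_sum]
  set μ := Measure.pi fun _ : Fin m => stdPi ι
  have hint : Integrable (fun D : Fin m → ι → ℝ => exp (1 * ∑ p, ∑ i, |D p i|)) μ := by
    rw [h1]
    exact Integrable.fintype_prod fun _ => hgi
  have hmgf : mgf (fun D : Fin m → ι → ℝ => ∑ p, ∑ i, |D p i|) μ 1 =
      (∫ x, f x ∂gaussianReal 0 1) ^ (m * Fintype.card ι) := by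
    rw [mgf, h1, integral_fintype_prod_eq_pow g, integral_prod_stdPi, ← pow_mul, Fintype.card_fin,
      mul_comm]
  have h := measure_ge_le_exp_mul_mgf (3 * (m * Fintype.card ι : ℝ)) zero_le_one hint
  have hle : ∫ x, f x ∂gaussianReal 0 1 ≤ exp 2 := by
    refine (integral_exp_mul_abs_gaussianReal_le 1).trans ?_
    have h2 : (2 : ℝ) ≤ exp 1 := by linarith [add_one_le_exp (1 : ℝ)]
    calc 2 * exp (1 ^ 2 / 2) ≤ exp 1 * exp 1 := by gcongr; norm_num
      _ = exp 2 := by rw [← exp_add]; norm_num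
  rw [← ENNReal.ofReal_toReal (measure_ne_top μ _)]
  refine ENNReal.ofReal_le_ofReal (h.trans ?_)
  rw [hmgf]
  calc _ ≤ exp (-1 * (3 * (m * Fintype.card ι))) * exp 2 ^ (m * Fintype.card ι) := by
        gcongr
    _ = _ := by
        rw [← exp_nat_mul, ← exp_add]
        congr 1
        push_cast
        ring

/-- Rounding towards zero. -/
theorem exists_int_natAbs_le_abs (x : ℝ) : ∃ n : ℤ, (n.natAbs : ℝ) ≤ |x| ∧ |x - n| ≤ 1 := by
  rcases le_total 0 x with h | h
  · refine ⟨⌊x⌋, ?_, ?_⟩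
    · rw [Nat.cast_natAbs, Int.cast_abs, abs_of_nonneg (by exact_mod_cast Int.floor_nonneg.mpr h),
        abs_of_nonneg h]
      exact Int.floor_le x
    · rw [abs_le]
      constructor <;> linarith [Int.floor_le x, Int.lt_floor_add_one x]
  · refine ⟨⌈x⌉, ?_, ?_⟩
    · have : ((⌈x⌉ : ℤ) : ℝ) ≤ 0 := by exact_mod_cast Int.ceil_le.mpr (by simpa using h)
      rw [Nat.cast_natAbs, Int.cast_abs, abs_of_nonpos this, abs_of_nonpos h]
      linarith [Int.le_ceil x]
    · rw [abs_le]
      constructor <;> linarith [Int.le_ceil x, Int.ceil_lt_add_one x]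

section

variable {ι : Type*} [Fintype ι] {H : Matrix ι ι ℝ}

theorem exists_gridVec_approx (K : ℕ) {z : ι → ℝ} (hz : ∑ i, z i ^ 2 = 1) :
    ∃ n : ι → ℤ, ∑ i, (n i).natAbs ^ 2 ≤ (2 ^ K) ^ 2 ∧
      ∀ i, |z i - gridVec K n i| ≤ 1 / 2 ^ K := by
  choose n h1 h2 using fun i => exists_int_natAbs_le_abs (z i * 2 ^ K)
  have hK : (0 : ℝ) < 2 ^ K := by positivity
  refine ⟨n, ?_, fun i => ?_⟩
  · have : ∑ i, ((n i).natAbs : ℝ) ^ 2 ≤ (2 ^ K) ^ 2 := by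
      calc _ ≤ ∑ i, (z i * 2 ^ K) ^ 2 := by
            refine Finset.sum_le_sum fun i _ => ?_
            rw [← sq_abs (z i * 2 ^ K)]
            exact pow_le_pow_left₀ (by positivity) (h1 i) 2
        _ = _ := by simp_rw [mul_pow]; rw [← Finset.sum_mul, hz, one_mul]
    exact_mod_cast this
  · rw [gridVec, le_div_iff₀ hK, ← abs_of_pos hK, ← abs_mul, abs_of_pos hK, sub_mul,
      div_mul_cancel₀ _ hK.ne']
    exact h2 i

theorem IsHadamardMatrix.abs_eq_one (hH : IsHadamardMatrix H) (q i : ι) : |H q i| = 1 :=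
  (pow_eq_one_iff_of_nonneg (abs_nonneg _) two_ne_zero).mp (by rw [sq_abs, hH.sq_eq_one])

theorem IsHadamardMatrix.abs_sum_le (hH : IsHadamardMatrix H) (x w : ι → ℝ) {b : ℝ}
    (hw : ∀ i, |w i| ≤ b) (q : ι) : |∑ i, H q i * (x i * w i)| ≤ b * ∑ i, |x i| := by
  refine (Finset.abs_sum_le_sum_abs _ _).trans ?_
  rw [Finset.mul_sum]
  refine Finset.sum_le_sum fun i _ => ?_
  rw [abs_mul, hH.abs_eq_one, one_mul, abs_mul, mul_comm]
  exact mul_le_mul_of_nonneg_right (hw i) (abs_nonneg _)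

theorem abs_transformAvg_sub_le_of_abs_sub_le {m : ℕ} {φ φ' : ℝ → ℝ} {w w' : ι → ℝ}
    {D : Fin m → ι → ℝ} {b : Fin m → ℝ}
    (h : ∀ p q, |φ (∑ i, H q i * (D p i * w i)) - φ' (∑ i, H q i * (D p i * w' i))| ≤ b p) :
    |transformAvg H φ w D - transformAvg H φ' w' D| ≤
      1 / (m * Fintype.card ι) * (Fintype.card ι * ∑ p, b p) := by
  rw [transformAvg, transformAvg, ← mul_sub, abs_mul, abs_of_nonneg (by positivity)]
  refine mul_le_mul_of_nonneg_left ?_ (by positivity)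
  rw [← Finset.sum_sub_distrib, Finset.mul_sum]
  refine (Finset.abs_sum_le_sum_abs _ _).trans (Finset.sum_le_sum fun p _ => ?_)
  rw [← Finset.sum_sub_distrib]
  refine (Finset.abs_sum_le_sum_abs _ _).trans ?_
  calc _ ≤ ∑ _q : ι, b p := Finset.sum_le_sum fun q _ => h p q
    _ = _ := by simp

theorem IsHadamardMatrix.abs_transformAvg_sub_transformAvg_le [Nonempty ι]
    (hH : IsHadamardMatrix H) {φ : ℝ → ℝ} (hφ : SmoothBounded φ) {m : ℕ} (hm : 0 < m)
    {w w' : ι → ℝ} {D : Fin m → ι → ℝ} {b : ℝ} (hb : ∀ i, |w i - w' i| ≤ b)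
    (hD : ∑ p, ∑ i, |D p i| ≤ 3 * (m * Fintype.card ι)) :
    |transformAvg H φ w D - transformAvg H φ w' D| ≤ 3 * Fintype.card ι * b := by
  have hd : (0 : ℝ) < Fintype.card ι := by exact_mod_cast Fintype.card_pos
  have hm0 : (0 : ℝ) < m := by exact_mod_cast hm
  have hb0 : 0 ≤ b := (abs_nonneg _).trans (hb (Classical.arbitrary ι))
  refine (abs_transformAvg_sub_le_of_abs_sub_le (b := fun p => b * ∑ i, |D p i|)
    fun p q => ?_).trans ?_
  · refine (hφ.abs_sub_le _ _).trans ?_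
    rw [← Finset.sum_sub_distrib]
    simp_rw [← mul_sub]
    exact hH.abs_sum_le (D p) (fun i => w i - w' i) hb q
  · rw [← Finset.mul_sum]
    calc _ ≤ 1 / (m * Fintype.card ι) * (Fintype.card ι * (b * (3 * (m * Fintype.card ι)))) := by
          gcongr
      _ = _ := by field_simp

theorem abs_sqrt_sum_sq_sub_one_le {z w : ι → ℝ} (hz : ∑ i, z i ^ 2 = 1) {b : ℝ}
    (hb : ∀ i, |z i - w i| ≤ b) : |√(∑ i, w i ^ 2) - 1| ≤ Fintype.card ι * b := by
  set x : EuclideanSpace ℝ ι := WithLp.toLp 2 w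
  set y : EuclideanSpace ℝ ι := WithLp.toLp 2 z
  have hx : ‖x‖ = √(∑ i, w i ^ 2) := by simp [x, EuclideanSpace.norm_eq]
  have hy : ‖y‖ = 1 := by simp [y, EuclideanSpace.norm_eq, hz]
  rw [← hx, ← hy]
  refine (abs_norm_sub_norm_le x y).trans ?_
  rw [norm_sub_rev, EuclideanSpace.norm_eq]
  have h1 : ∑ i, ‖(y - x) i‖ ^ 2 ≤ (∑ i, |z i - w i|) ^ 2 := by
    have := Finset.sum_sq_le_sq_sum_of_nonneg (s := Finset.univ) (f := fun i => |z i - w i|)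
      fun i _ => abs_nonneg _
    simpa [x, y] using this
  refine (sqrt_le_sqrt h1).trans ?_
  rw [sqrt_sq (Finset.sum_nonneg fun _ _ => abs_nonneg _)]
  calc _ ≤ ∑ _i : ι, b := Finset.sum_le_sum fun i _ => hb i
    _ = _ := by simp

/-- Outside the exceptional events, the empirical average of a function close to `φ` over the
transform of a unit vector is close to its Gaussian mean. -/
theorem IsHadamardMatrix.abs_transformAvg_sub_integral_le [Nonempty ι] (hH : IsHadamardMatrix H)
    {φ ψ : ℝ → ℝ} (hφ : SmoothBounded φ) (hψ : Integrable ψ (gaussianReal 0 1)) {κ : ℝ}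
    (hκ : ∀ x, |φ x - ψ x| ≤ κ) {m : ℕ} (hm : 0 < m) {τ : ℝ} {K : ℕ} {D : Fin m → ι → ℝ}
    (hbad : D ∉ ⋃ j ∈ Finset.range (K + 1),
        ⋃ n ∈ gridLevel ι K j, ⋃ k ∈ Finset.range ((2 ^ K) ^ 2 + 1), gridBad H m φ τ K j k n)
    (hD : ∑ p, ∑ i, |D p i| ≤ 3 * (m * Fintype.card ι))
    {z : ι → ℝ} (hz : ∑ i, z i ^ 2 = 1) :
    |transformAvg H ψ z D - ∫ x, ψ x ∂gaussianReal 0 1| ≤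
      2 * κ + 4 * (Fintype.card ι / 2 ^ K) + (K + 1) * τ := by
  have hd : (0 : ℝ) < Fintype.card ι := by exact_mod_cast Fintype.card_pos
  have hm0 : (0 : ℝ) < m := by exact_mod_cast hm
  obtain ⟨n, hn, hnz⟩ := exists_gridVec_approx K hz
  have h1 : |transformAvg H φ z D - transformAvg H ψ z D| ≤ κ := by
    refine (abs_transformAvg_sub_le_of_abs_sub_le (b := fun _ => κ) fun p q => hκ _).trans_eq ?_
    simp
    field_simp
  have h2 := hH.abs_transformAvg_sub_transformAvg_le hφ hm hnz hD
  have h3 := abs_transformAvg_gridVec_sub_le hm hbad hn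
  have h4 := abs_gaussSmooth_sub_gaussSmooth_one_le hφ
    (((∑ i, (n i).natAbs ^ 2 : ℕ) : ℝ≥0) / (2 ^ K) ^ 2)
  have h5 := abs_sqrt_sum_sq_sub_one_le hz hnz
  have hv : ((((∑ i, (n i).natAbs ^ 2 : ℕ) : ℝ≥0) / (2 ^ K) ^ 2 : ℝ≥0) : ℝ) =
      ∑ i, gridVec K n i ^ 2 := by
    push_cast
    rw [Finset.sum_div]
    refine Finset.sum_congr rfl fun i _ => ?_
    rw [gridVec, div_pow, Nat.cast_natAbs, Int.cast_abs, sq_abs]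
  rw [hv] at h4
  have h8 := h4.trans h5
  have h6 : |gaussSmooth φ 1 0 - ∫ x, ψ x ∂gaussianReal 0 1| ≤ κ := by
    have hi : Integrable φ (gaussianReal 0 1) := hφ.integrable_comp measurable_id
    have h0 : gaussSmooth φ 1 0 = ∫ x, φ x ∂gaussianReal 0 1 := by simp [gaussSmooth]
    rw [h0, ← integral_sub hi hψ]
    have := norm_integral_le_of_norm_le_const (μ := gaussianReal 0 1)
      (f := fun t => φ t - ψ t) (C := κ) (Filter.Eventually.of_forall fun t => hκ t)
    simpa using this
  have h7 : 3 * (Fintype.card ι : ℝ) * (1 / 2 ^ K) + Fintype.card ι * (1 / 2 ^ K) =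
      4 * (Fintype.card ι / 2 ^ K) := by ring
  rw [abs_le] at *
  constructor <;> linarith [h1.1, h1.2, h2.1, h2.2, h3.1, h3.2, h8.1, h8.2, h6.1, h6.2]

end

theorem isHadamardMatrix_Had : ∀ ℓ, IsHadamardMatrix (Had ℓ)
  | 0 => by
    refine ⟨fun q i => ?_, ?_⟩
    · obtain rfl : q = i := Subsingleton.elim (α := Fin 1) _ _
      rw [Had, Matrix.one_apply_eq, one_pow]
    · ext q i
      obtain rfl : q = i := Subsingleton.elim (α := Fin 1) _ _
      rw [Had, Matrix.transpose_one, mul_one]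
      simp only [Matrix.smul_apply, Matrix.one_apply, if_true]
      simp
  | ℓ + 1 => by
    have ih := isHadamardMatrix_Had ℓ
    refine ⟨fun q i => ?_, ?_⟩
    · rw [Had, Matrix.reindex_apply, Matrix.submatrix_apply]
      rcases Equiv.symm _ q with a | a <;> rcases Equiv.symm _ i with b | b <;>
        simpa [Matrix.fromBlocks] using ih.sq_eq_one a b
    · set c : ℝ := (Fintype.card (Fin (2 ^ ℓ)) : ℝ) with hc
      have hcard : (Fintype.card (Fin (2 ^ (ℓ + 1))) : ℝ) = 2 * c := by
        simp [hc, pow_succ, mul_comm]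
      have hmul : Had ℓ * (Had ℓ).transpose = c • 1 := by
        convert ih.mul_transpose
      have hblock : Matrix.fromBlocks ((2 * c) • (1 : Matrix (Fin (2 ^ ℓ)) (Fin (2 ^ ℓ)) ℝ)) 0 0
          ((2 * c) • (1 : Matrix (Fin (2 ^ ℓ)) (Fin (2 ^ ℓ)) ℝ)) = (2 * c) • 1 := by
        rw [← Matrix.fromBlocks_one, Matrix.fromBlocks_smul, smul_zero]
      rw [Had, Matrix.reindex_apply, Matrix.transpose_submatrix, Matrix.submatrix_mul_equiv,
        Matrix.fromBlocks_transpose, Matrix.fromBlocks_multiply]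
      simp only [Matrix.transpose_neg, Matrix.mul_neg, Matrix.neg_mul, neg_neg, hmul,
        add_neg_cancel, ← two_smul ℝ, smul_smul]
      rw [hblock, Matrix.submatrix_smul, hcard]
      ext q i
      by_cases h : q = i <;> simp [h]

theorem exceptional_bound_le {K : ℕ} {a d δ : ℝ} (hδ : δ ∈ Set.Ioo (0 : ℝ) (1 / 2))
    (hd : 1 ≤ d) (hK : 64 * d ≤ 2 ^ K) (ha : exp (-a) ≤ δ / (2 ^ K) ^ 2) :
    (K + 1) * (((2 ^ K) ^ 2 + 1) * (2 * exp (-(4 * a)) * exp (2 * 2 ^ K * d * exp (-a)))) ≤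
      δ / 32 := by
  obtain ⟨hδ0, hδ1⟩ := hδ
  have hKM : (K + 1 : ℝ) ≤ 2 ^ K := by exact_mod_cast Nat.lt_two_pow_self (n := K)
  set M : ℝ := 2 ^ K with hM
  have hM64 : 64 ≤ M := by linarith
  have hM0 : 0 < M := by linarith
  have h1 : exp (2 * M * d * exp (-a)) ≤ 3 := by
    have : 2 * M * d * exp (-a) ≤ 1 := by
      calc 2 * M * d * exp (-a) ≤ 2 * M * d * (δ / M ^ 2) := by gcongr
        _ = (2 * d * δ) / M := by field_simp
        _ ≤ 1 := by rw [div_le_one hM0]; nlinarith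
    exact (exp_le_exp.mpr this).trans (by linarith [exp_one_lt_d9])
  have h2 : exp (-(4 * a)) ≤ (δ / M ^ 2) ^ 4 := by
    rw [show -(4 * a) = (4 : ℕ) * (-a) by push_cast; ring, exp_nat_mul]
    exact pow_le_pow_left₀ (exp_pos _).le ha 4
  calc (K + 1) * ((M ^ 2 + 1) * (2 * exp (-(4 * a)) * exp (2 * M * d * exp (-a))))
      ≤ M * ((M ^ 2 + M ^ 2) * (2 * (δ / M ^ 2) ^ 4 * 3)) := by
        gcongr
        nlinarith
    _ = 12 * δ ^ 4 / M ^ 5 := by field_simp; ring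
    _ ≤ δ / 32 := by
        rw [div_le_div_iff₀ (by positivity) (by norm_num)]
        have hM5 : (64 : ℝ) ^ 5 ≤ M ^ 5 := by gcongr
        have hδ4 : δ ^ 4 ≤ δ := by
          calc δ ^ 4 ≤ δ ^ 1 := pow_le_pow_of_le_one hδ0.le (by linarith) (by norm_num)
            _ = δ := pow_one δ
        nlinarith [mul_le_mul_of_nonneg_left hM5 hδ0.le]

/-- The scale and the accuracy used for the grid, given the number of repetitions. -/
theorem exists_grid_parameters {d ε δ : ℝ} (hd : 1 ≤ d) (hε : ε ∈ Set.Ioo (0 : ℝ) (1 / 2))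
    (hδ : δ ∈ Set.Ioo (0 : ℝ) (1 / 2)) {m : ℝ}
    (hm : 173056000 * ε⁻¹ ^ 2 * log (d / ε) ^ 5 * log (1 / δ) ≤ m) :
    ∃ K : ℕ, 64 * d / ε ≤ 2 ^ K ∧
      exp (-((ε / (16 * (K + 1))) ^ 2 * m / 40)) ≤ δ / (2 ^ K) ^ 2 ∧ exp (-m) ≤ δ / 16 := by
  obtain ⟨hε0, hε1⟩ := hε
  obtain ⟨hδ0, hδ1⟩ := hδ
  have hl2 := log_two_gt_d9
  have hx : 1 ≤ 64 * d / ε := by rw [le_div_iff₀ hε0]; linarith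
  obtain ⟨n, hn1, hn2⟩ := exists_nat_pow_near hx (one_lt_two (α := ℝ))
  set Λ := log (d / ε) with hΛ
  set L := log (1 / δ) with hL
  have hdε : 2 ≤ d / ε := by rw [le_div_iff₀ hε0]; nlinarith
  have hΛ2 : log 2 ≤ Λ := log_le_log two_pos hdε
  have hL2 : log 2 ≤ L := log_le_log two_pos (by rw [le_div_iff₀ hδ0]; linarith)
  have hnlog : n * log 2 ≤ 6 * log 2 + Λ := by
    have h := log_le_log (by positivity) hn1
    rw [log_pow, mul_div_assoc, log_mul (by norm_num) (by positivity),
      show (64 : ℝ) = 2 ^ 6 by norm_num, log_pow] at h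
    exact_mod_cast h
  have hΛ0 : 0 < Λ := by linarith
  have hL0 : 0 < L := by linarith
  have hΛs : 0.476 ≤ Λ ^ 2 := by nlinarith
  have hm' : 173056000 * (Λ ^ 5 * L) ≤ ε ^ 2 * m := by
    have := mul_le_mul_of_nonneg_left hm (sq_nonneg ε)
    refine le_trans (le_of_eq ?_) this
    field_simp
  have hm0 : 0 ≤ m := le_trans (by positivity) hm
  refine ⟨n + 1, hn2.le, ?_, ?_⟩
  · have hK1 : ((n + 1 : ℕ) : ℝ) + 1 ≤ 13 * Λ := by
      push_cast
      nlinarith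
    have hKlog : ((n + 1 : ℕ) : ℝ) * log 2 ≤ 8 * Λ := by
      push_cast
      nlinarith
    set k : ℝ := ((n + 1 : ℕ) : ℝ) with hk
    have hk0 : 0 ≤ k := by positivity
    have ha : 2 * (k * log 2) + L ≤ (ε / (16 * (k + 1))) ^ 2 * m / 40 := by
      calc 2 * (k * log 2) + L ≤ 16 * Λ + L := by linarith
        _ ≤ 100 * (Λ ^ 3 * L) := by
            have h1 : 0.32 ≤ Λ ^ 2 * L := by nlinarith
            have h2 : 0.32 ≤ Λ ^ 3 := by nlinarith
            nlinarith [mul_le_mul_of_nonneg_left h1 hΛ0.le, mul_le_mul_of_nonneg_right h2 hL0.le]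
        _ = 173056000 * (Λ ^ 5 * L) / (16 * (13 * Λ)) ^ 2 / 40 := by field_simp; ring
        _ ≤ ε ^ 2 * m / (16 * (k + 1)) ^ 2 / 40 := by gcongr
        _ = _ := by rw [div_pow]; ring
    calc exp (-((ε / (16 * (k + 1))) ^ 2 * m / 40)) ≤ exp (-(2 * (k * log 2) + L)) :=
          exp_le_exp.mpr (neg_le_neg ha)
      _ = δ / (2 ^ (n + 1)) ^ 2 := by
          rw [neg_add, exp_add, hL, one_div, log_inv, neg_neg, exp_log hδ0, exp_neg,
            show 2 * (k * log 2) = (2 : ℕ) * (((n + 1 : ℕ) : ℝ) * log 2) by push_cast [hk]; ring,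
            exp_nat_mul, exp_nat_mul, exp_log two_pos]
          ring
  · have h1 : 5 * L ≤ m := by
      have h3 : ε ^ 2 * m ≤ m := mul_le_of_le_one_left hm0 (by nlinarith)
      have h4 : 0.1 ≤ Λ ^ 5 := by
        have : Λ ^ 5 = Λ ^ 2 * Λ ^ 2 * Λ := by ring
        rw [this]
        nlinarith [mul_le_mul hΛs hΛs (by norm_num) (by positivity)]
      nlinarith [mul_le_mul_of_nonneg_right h4 hL0.le]
    calc exp (-m) ≤ exp ((5 : ℕ) * -L) := exp_le_exp.mpr (by push_cast; linarith)
      _ = δ ^ 5 := by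
          rw [exp_nat_mul, hL, one_div, log_inv, neg_neg, exp_log hδ0]
      _ = δ ^ 4 * δ := by ring
      _ ≤ (1 / 2) ^ 4 * δ := by gcongr
      _ = δ / 16 := by ring

theorem transformAvg_mono {ι : Type*} [Fintype ι] {H : Matrix ι ι ℝ} {m : ℕ} {φ φ' : ℝ → ℝ}
    {w : ι → ℝ} {D : Fin m → ι → ℝ}
    (h : ∀ p q, φ (∑ i, H q i * (D p i * w i)) ≤ φ' (∑ i, H q i * (D p i * w i))) :
    transformAvg H φ w D ≤ transformAvg H φ' w D :=
  mul_le_mul_of_nonneg_left (Finset.sum_le_sum fun p _ => Finset.sum_le_sum fun q _ => h p q)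
    (by positivity)

theorem two_mul_exp_neg_div_le {ε r : ℝ} (hε : ε ∈ Set.Ioo (0 : ℝ) (1 / 2))
    (hr : r = 4 * √(log (1 / ε))) : 2 * exp (-(r ^ 2 / 2)) / r ≤ ε / 64 := by
  obtain ⟨hε0, hε1⟩ := hε
  have hlog : log 2 ≤ log (1 / ε) := log_le_log two_pos (by rw [le_div_iff₀ hε0]; linarith)
  have hlog0 : 0.69 ≤ log (1 / ε) := by linarith [log_two_gt_d9]
  have hr2 : 2 ≤ r := by
    have : 1 / 2 ≤ √(log (1 / ε)) := le_sqrt_of_sq_le (by linarith)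
    rw [hr]
    linarith
  have he : exp (-(r ^ 2 / 2)) = ε ^ 8 := by
    rw [hr, mul_pow, sq_sqrt (by linarith), one_div, log_inv,
      show -(4 ^ 2 * -log ε / 2) = (8 : ℕ) * log ε by push_cast; ring, exp_nat_mul, exp_log hε0]
  rw [he, div_le_iff₀ (by linarith)]
  have h7 : ε ^ 7 ≤ (1 / 2) ^ 7 := by gcongr
  calc 2 * ε ^ 8 = 2 * (ε ^ 7 * ε) := by ring
    _ ≤ 2 * ((1 / 2) ^ 7 * ε) := by gcongr
    _ ≤ ε / 64 * r := by nlinarith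

theorem IsHadamardMatrix.measure_iUnion_gridBad_smoothTrunc_le {ι : Type*} [Fintype ι] [Nonempty ι]
    {H : Matrix ι ι ℝ} (hH : IsHadamardMatrix H) {m : ℕ} (hm : 0 < m) {δ τ κ r : ℝ} {K : ℕ}
    (hδ : δ ∈ Set.Ioo (0 : ℝ) (1 / 2)) (hτ : 0 ≤ τ) (hκ : 0 < κ) (hr : 0 ≤ r)
    (hK : 64 * (Fintype.card ι : ℝ) ≤ 2 ^ K)
    (hexp : exp (-(τ ^ 2 * m / 40)) ≤ δ / (2 ^ K) ^ 2) :
    (Measure.pi fun _ : Fin m => stdPi ι) (⋃ j ∈ Finset.range (K + 1),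
        ⋃ n ∈ gridLevel ι K j, ⋃ k ∈ Finset.range ((2 ^ K) ^ 2 + 1),
          gridBad H m (smoothTrunc κ r) τ K j k n) ≤ ENNReal.ofReal (δ / 32) :=
  (measure_iUnion_gridBad_le hH (smoothBounded_smoothTrunc hκ hr) hm hτ K).trans
    (ENNReal.ofReal_le_ofReal (exceptional_bound_le hδ
      (by exact_mod_cast Fintype.card_pos (α := ι)) hK hexp))

theorem IsHadamardMatrix.measure_truncated_transformAvg_ge {ι : Type*} [Fintype ι] [Nonempty ι]
    {H : Matrix ι ι ℝ} (hH : IsHadamardMatrix H) {m : ℕ} (hm : 0 < m) {ε δ : ℝ}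
    (hε : ε ∈ Set.Ioo (0 : ℝ) (1 / 2)) (hδ : δ ∈ Set.Ioo (0 : ℝ) (1 / 2))
    (hmC : 173056000 * ε⁻¹ ^ 2 * log (Fintype.card ι / ε) ^ 5 * log (1 / δ) ≤ (m : ℝ)) :
    ENNReal.ofReal (1 - δ / 4) ≤ (Measure.pi fun _ : Fin m => stdPi ι)
      {D | ∀ z : ι → ℝ, ∑ i, z i ^ 2 = 1 → ∀ r, 4 * √(log (1 / ε)) ≤ r →
        |√(π / 2) * transformAvg H (fun x => min |x| r) z D - 1| ≤ ε / 2} := by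
  have hd : (1 : ℝ) ≤ Fintype.card ι := by exact_mod_cast Fintype.card_pos (α := ι)
  obtain ⟨K, hK, hexp, hexpm⟩ := exists_grid_parameters hd hε hδ hmC
  obtain ⟨hε0, hε1⟩ := id hε
  obtain ⟨hδ0, hδ1⟩ := id hδ
  set d : ℝ := (Fintype.card ι : ℝ)
  set κ : ℝ := ε / 64 with hκ
  have hκ0 : 0 < κ := by positivity
  set τ : ℝ := ε / (16 * (K + 1)) with hτ
  have hτ0 : 0 ≤ τ := by positivity
  set r₀ : ℝ := 4 * √(log (1 / ε)) with hr₀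
  have hr₀0 : 0 < r₀ := by
    have : 0 < log (1 / ε) := log_pos (by rw [lt_div_iff₀ hε0]; linarith)
    positivity
  set r₁ : ℝ := 3 * (m * d) with hr₁
  have hr₁0 : 0 ≤ r₁ := by positivity
  have hKd : 64 * d ≤ 2 ^ K :=
    le_trans (by rw [le_div_iff₀ hε0]; nlinarith) hK
  have hdK : d / 2 ^ K ≤ ε / 64 := by
    rw [div_le_iff₀ hε0] at hK
    rw [div_le_iff₀ (by positivity)]
    linarith
  have hKτ : (K + 1) * τ = ε / 16 := by rw [hτ]; field_simp
  set μ := Measure.pi fun _ : Fin m => stdPi ι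
  set bad : ℝ → Set (Fin m → ι → ℝ) := fun r => ⋃ j ∈ Finset.range (K + 1),
    ⋃ n ∈ gridLevel ι K j, ⋃ k ∈ Finset.range ((2 ^ K) ^ 2 + 1),
      gridBad H m (smoothTrunc κ r) τ K j k n
  have hbad_le : ∀ r, 0 ≤ r → μ (bad r) ≤ ENNReal.ofReal (δ / 32) := fun r hr =>
    hH.measure_iUnion_gridBad_smoothTrunc_le hm hδ hτ0 hκ0 hr hKd hexp
  set large : Set (Fin m → ι → ℝ) := {D | 3 * (m * d) ≤ ∑ p, ∑ i, |D p i|}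
  have hlarge_le : μ large ≤ ENNReal.ofReal (δ / 16) := by
    refine (measure_sum_abs_ge_le_s14 ι m).trans (ENNReal.ofReal_le_ofReal (le_trans ?_ hexpm))
    exact exp_le_exp.mpr (neg_le_neg (le_mul_of_one_le_right (Nat.cast_nonneg _) hd))
  set good : Set (Fin m → ι → ℝ) := {D | ∀ z : ι → ℝ, ∑ i, z i ^ 2 = 1 → ∀ r, r₀ ≤ r →
    |√(π / 2) * transformAvg H (fun x => min |x| r) z D - 1| ≤ ε / 2}
  have hcover : Set.univ ⊆ good ∪ (bad r₀ ∪ bad r₁ ∪ large) := by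
    intro D _
    by_contra hD
    simp only [Set.mem_union, not_or] at hD
    obtain ⟨hDg, ⟨hD0, hD1⟩, hDl⟩ := hD
    refine hDg fun z hz r hr => ?_
    have hDs : ∑ p, ∑ i, |D p i| ≤ 3 * (m * d) := (not_le.mp hDl).le
    have hz1 : ∀ i, |z i| ≤ 1 := fun i => by
      rw [← sq_le_one_iff_abs_le_one, ← hz]
      exact Finset.single_le_sum (f := fun i => z i ^ 2) (fun _ _ => sq_nonneg _)
        (Finset.mem_univ i)
    have herr : ∀ s, 0 ≤ s → D ∉ bad s → |transformAvg H (fun x => min |x| s) z D -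
        ∫ x, min |x| s ∂gaussianReal 0 1| ≤ 2 * κ + 4 * (d / 2 ^ K) + (K + 1) * τ := by
      intro s hs hDs'
      exact hH.abs_transformAvg_sub_integral_le (smoothBounded_smoothTrunc hκ0 hs)
        (integrable_min_abs_gaussianReal hs) (abs_smoothTrunc_sub_le hκ0 s) hm hDs' hDs hz
    have hlow : transformAvg H (fun x => min |x| r₀) z D ≤
        transformAvg H (fun x => min |x| r) z D :=
      transformAvg_mono fun p q => min_le_min_left _ hr
    have hup : transformAvg H (fun x => min |x| r) z D ≤
        transformAvg H (fun x => min |x| r₁) z D := by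
      refine transformAvg_mono fun p q => le_min (min_le_left _ _) ((min_le_left _ _).trans ?_)
      have h1 := hH.abs_sum_le (D p) z hz1 q
      rw [one_mul] at h1
      have h2 := Finset.single_le_sum (f := fun p => ∑ i, |D p i|)
        (fun p _ => Finset.sum_nonneg fun i _ => abs_nonneg (D p i)) (Finset.mem_univ p)
      linarith
    have h0 := abs_le.mp (herr r₀ hr₀0.le hD0)
    have h1 := abs_le.mp (herr r₁ hr₁0 hD1)
    have h2 := sub_le_integral_min_abs_gaussianReal hr₀0
    have h3 := two_mul_exp_neg_div_le hε hr₀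
    have h4 := integral_min_abs_gaussianReal_le hr₁0
    have hclose : |transformAvg H (fun x => min |x| r) z D - √(2 / π)| ≤ ε / 4 := by
      rw [abs_le]
      constructor <;> linarith [h0.1, h1.2]
    have hone : √(π / 2) * √(2 / π) = 1 := by
      rw [← sqrt_mul (by positivity), div_mul_div_cancel₀ two_ne_zero, div_self pi_ne_zero,
        sqrt_one]
    have htwo : √(π / 2) ≤ 2 := by
      rw [sqrt_le_left (by norm_num)]
      linarith [pi_le_four]
    calc _ = √(π / 2) * |transformAvg H (fun x => min |x| r) z D - √(2 / π)| := by
          rw [← abs_of_nonneg (sqrt_nonneg (π / 2)), ← abs_mul, abs_of_nonneg (sqrt_nonneg _),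
            mul_sub, hone]
      _ ≤ 2 * (ε / 4) := by gcongr
      _ = ε / 2 := by ring
  have hbad_total : μ (bad r₀ ∪ bad r₁ ∪ large) ≤ ENNReal.ofReal (δ / 4) := by
    calc _ ≤ μ (bad r₀) + μ (bad r₁) + μ large :=
          (measure_union_le _ _).trans (add_le_add_left (measure_union_le _ _) _)
      _ ≤ ENNReal.ofReal (δ / 32) + ENNReal.ofReal (δ / 32) + ENNReal.ofReal (δ / 16) :=
          add_le_add (add_le_add (hbad_le r₀ hr₀0.le) (hbad_le r₁ hr₁0)) hlarge_le
      _ = ENNReal.ofReal (δ / 32 + δ / 32 + δ / 16) := by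
          rw [ENNReal.ofReal_add (by positivity) (by positivity),
            ENNReal.ofReal_add (by positivity) (by positivity)]
      _ ≤ _ := ENNReal.ofReal_le_ofReal (by linarith)
  rw [ENNReal.ofReal_sub _ (by positivity), ENNReal.ofReal_one, tsub_le_iff_right]
  calc (1 : ℝ≥0∞) = μ Set.univ := measure_univ.symm
    _ ≤ μ good + μ (bad r₀ ∪ bad r₁ ∪ large) := (measure_mono hcover).trans (measure_union_le _ _)
    _ ≤ _ := add_le_add_right hbad_total _

/-- Claim 5.2: uniform concentration of the truncated empirical
first moment of the RHT entries, where `ψ_r(x) = min(|x|, r)`. -/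
theorem rht_truncated_moment_concentration :
    ∃ C : ℝ, 0 < C ∧
      ∀ (ℓ : ℕ) (ε δ : ℝ), ε ∈ Set.Ioo (0 : ℝ) (1 / 2) → δ ∈ Set.Ioo (0 : ℝ) (1 / 2) →
        ∀ m : ℕ, C * ε⁻¹ ^ 2 * Real.log (2 ^ ℓ / ε) ^ 5 * Real.log (1 / δ) ≤ (m : ℝ) →
          ENNReal.ofReal (1 - δ / 4) ≤
            diagMeasure ℓ m
              {D | ∀ z : EuclideanSpace ℝ (Fin (2 ^ ℓ)), ‖z‖ = 1 →
                ∀ r : ℝ, 4 * Real.sqrt (Real.log (1 / ε)) ≤ r →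
                  1 - ε / 2 ≤
                      (1 / ((m : ℝ) * 2 ^ ℓ)) * Real.sqrt (Real.pi / 2) *
                        ∑ p, ∑ q, min |rht ℓ m D z p q| r ∧
                    (1 / ((m : ℝ) * 2 ^ ℓ)) * Real.sqrt (Real.pi / 2) *
                        ∑ p, ∑ q, min |rht ℓ m D z p q| r ≤ 1 + ε / 2} := by
  refine ⟨173056000, by norm_num, fun ℓ ε δ hε hδ m hm => ?_⟩
  have hcard : (Fintype.card (Fin (2 ^ ℓ)) : ℝ) = 2 ^ ℓ := by simp
  have hm0 : 0 < m := by
    have h1 : 0 < log (2 ^ ℓ / ε) :=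
      log_pos (by
        rw [lt_div_iff₀ hε.1]
        linarith [hε.2, one_le_pow₀ (one_le_two (α := ℝ)) (n := ℓ)])
    have h2 : 0 < log (1 / δ) := log_pos (by rw [lt_div_iff₀ hδ.1]; linarith [hδ.2])
    have h3 : 0 < ε := hε.1
    exact Nat.cast_pos.mp (lt_of_lt_of_le (by positivity) hm)
  refine ((isHadamardMatrix_Had ℓ).measure_truncated_transformAvg_ge hm0 hε hδ
    (by rwa [hcard])).trans (measure_mono fun D hD z hz r hr => ?_)
  have hz' : ∑ i, z i ^ 2 = 1 := by
    have := EuclideanSpace.norm_sq_eq z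
    simpa [hz] using this.symm
  have h := hD z hz' r hr
  have heq : √(π / 2) * transformAvg (Had ℓ) (fun x => min |x| r) z D =
      1 / ((m : ℝ) * 2 ^ ℓ) * √(π / 2) * ∑ p, ∑ q, min |rht ℓ m D z p q| r := by
    rw [transformAvg, hcard, ← mul_assoc, mul_comm (√(π / 2))]
    rfl
  rw [heq, abs_le] at h
  constructor <;> linarith [h.1, h.2]
end
end
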